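/- arXiv:1910.04447 — 4 statements merged into one kernel-verified Lean document; each statement's English description precedes it below -/
import Mathlib

section
/- Let H be a separable Hilbert space and let f = (f_j)_{j≥0} be an H-valued martingale relative to a filtration (F_j)_{j≥0} with F_0 trivial. Suppose there exists a nonnegative predictable sequence w = (w_j)_{j≥1} such that ‖d_j‖ ≤ w_j almost surely for every j ≥ 1. Then for every real b ≥ ‖Σ_{j≥1} w_j²‖_{L^∞} and every r > 0, one has P(f* ≥ r) ≤ 2·exp(−r²/(2b)). -/
open MeasureTheory
open scoped ENNReal NNReal

lemma cosh_chord {a w t s : ℝ} (hs : 0 ≤ s) (h1 : -1 ≤ t) (h2 : t ≤ 1)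
    (h : s ^ 2 ≤ a ^ 2 + w ^ 2 + 2 * (a * w * t)) :
    Real.cosh s ≤ Real.cosh a * Real.cosh w + t * (Real.sinh a * Real.sinh w) := by
  have e : Real.cosh a * Real.cosh w + t * (Real.sinh a * Real.sinh w)
      = (1 + t) / 2 * Real.cosh (a + w) + (1 - t) / 2 * Real.cosh (a - w) := by
    rw [Real.cosh_add, Real.cosh_sub]; ring
  rw [e]
  refine hasSum_le ?_ (Real.hasSum_cosh s)
    (((Real.hasSum_cosh (a + w)).mul_left ((1 + t) / 2)).add
      ((Real.hasSum_cosh (a - w)).mul_left ((1 - t) / 2)))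
  intro k
  have hc := (convexOn_pow (𝕜 := ℝ) k).2
    (Set.mem_Ici.2 (sq_nonneg (a + w))) (Set.mem_Ici.2 (sq_nonneg (a - w)))
    (show 0 ≤ (1 + t) / 2 by linarith) (show 0 ≤ (1 - t) / 2 by linarith) (by ring)
  simp only [smul_eq_mul] at hc
  have h3 : (s ^ 2) ^ k ≤ ((1 + t) / 2 * (a + w) ^ 2 + (1 - t) / 2 * (a - w) ^ 2) ^ k := by
    gcongr
    nlinarith
  have h4 := h3.trans hc
  rw [pow_mul, pow_mul, pow_mul]
  have hf : (0 : ℝ) < (2 * k).factorial := by positivity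
  calc _ ≤ ((1 + t) / 2 * ((a + w) ^ 2) ^ k + (1 - t) / 2 * ((a - w) ^ 2) ^ k)
        / (2 * k).factorial := by gcongr
    _ = _ := by ring

lemma cosh_norm_add {H : Type*} [NormedAddCommGroup H] [InnerProductSpace ℝ H]
    (x d : H) {w : ℝ} (hd : ‖d‖ ≤ w) :
    Real.cosh ‖x + d‖ ≤ Real.cosh ‖x‖ * Real.cosh w
      + inner ℝ ((Real.sinh ‖x‖ * Real.sinh w / (‖x‖ * w)) • x) d := by
  have hw : 0 ≤ w := (norm_nonneg d).trans hd
  rw [real_inner_smul_left]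
  have hi := abs_le.1 (abs_real_inner_le_norm x d)
  have hn : ‖x + d‖ ^ 2 ≤ ‖x‖ ^ 2 + w ^ 2 + 2 * inner ℝ x d := by
    rw [norm_add_sq_real]
    have : ‖d‖ ^ 2 ≤ w ^ 2 := by gcongr
    linarith
  have hle : ‖x‖ * ‖d‖ ≤ ‖x‖ * w := by gcongr
  rcases (mul_nonneg (norm_nonneg x) hw).eq_or_lt with h0 | h0
  · have hz : inner ℝ x d = (0 : ℝ) := by linarith [hi.1, hi.2]
    have := cosh_chord (a := ‖x‖) (w := w) (t := 0) (norm_nonneg (x + d)) (by norm_num) (by norm_num)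
      (by rw [hz] at hn; linarith)
    rw [hz]; linarith
  · have := cosh_chord (a := ‖x‖) (w := w) (t := inner ℝ x d / (‖x‖ * w)) (norm_nonneg (x + d))
      (by rw [le_div_iff₀ h0]; linarith) (by rw [div_le_iff₀ h0]; linarith)
      (by rw [mul_div_cancel₀ _ h0.ne']; exact hn)
    calc _ ≤ _ := this
      _ = _ := by ring

lemma norm_coef {H : Type*} [NormedAddCommGroup H] [InnerProductSpace ℝ H]
    (x d : H) {w : ℝ} (hd : ‖d‖ ≤ w) :
    |inner ℝ ((Real.sinh ‖x‖ * Real.sinh w / (‖x‖ * w)) • x) d| ≤ Real.sinh ‖x‖ * Real.sinh w := by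
  have hw : 0 ≤ w := (norm_nonneg d).trans hd
  have h1 : 0 ≤ Real.sinh ‖x‖ * Real.sinh w :=
    mul_nonneg (Real.sinh_nonneg_iff.2 (norm_nonneg _)) (Real.sinh_nonneg_iff.2 hw)
  refine (abs_real_inner_le_norm _ _).trans ?_
  rw [norm_smul, Real.norm_of_nonneg (by positivity)]
  have hle : ‖x‖ * ‖d‖ ≤ ‖x‖ * w := by gcongr
  rcases (mul_nonneg (norm_nonneg x) hw).eq_or_lt with h0 | h0
  · rw [← h0]; simpa
  · rw [div_mul_eq_mul_div, div_mul_eq_mul_div, div_le_iff₀ h0, mul_assoc]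
    gcongr

lemma integral_inner_zero
    {Ω H : Type*} {m0 m : MeasurableSpace Ω} {μ : Measure Ω} [IsProbabilityMeasure μ]
    [NormedAddCommGroup H] [InnerProductSpace ℝ H] [CompleteSpace H]
    (hm : m0 ≤ m) {U d : Ω → H} (hU : StronglyMeasurable[m0] U) (hd : Integrable d μ)
    (hd0 : μ[d | m0] =ᵐ[μ] 0) (hUd : Integrable (fun ω => (inner ℝ (U ω) (d ω) : ℝ)) μ)
    {A : Set Ω} (hA : MeasurableSet[m0] A) :
    ∫ ω in A, (inner ℝ (U ω) (d ω) : ℝ) ∂μ = 0 := by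
  rw [← setIntegral_condExp hm hUd hA]
  have := condExp_bilin_of_stronglyMeasurable_left (μ := μ) (innerSL ℝ : H →L[ℝ] H →L[ℝ] ℝ) hU hUd hd
  have h2 : μ[(fun ω => (inner ℝ (U ω) (d ω) : ℝ)) | m0] =ᵐ[μ] 0 := by
    refine this.trans ?_
    filter_upwards [hd0] with ω h
    simp [h]
  rw [integral_congr_ae (ae_restrict_of_ae h2)]
  simp

section core
variable {Ω H : Type*} {m : MeasurableSpace Ω} {μ : Measure Ω} [IsProbabilityMeasure μ]
    [NormedAddCommGroup H] [InnerProductSpace ℝ H] [CompleteSpace H]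

lemma azuma_step
    (ℱ : Filtration ℕ m) (f : ℕ → Ω → H) (hf : Martingale f ℱ μ)
    (w : ℕ → Ω → ℝ)
    (hw_pred : ∀ j : ℕ, StronglyMeasurable[ℱ j] (w (j + 1)))
    (hdom : ∀ j : ℕ, ∀ᵐ ω ∂μ, ‖f (j + 1) ω - f j ω‖ ≤ w (j + 1) ω)
    (b : ℝ) (hwb : ∀ j, ∀ᵐ ω ∂μ, w (j + 1) ω ≤ b) (n : ℕ) :
    Integrable (fun ω => Real.cosh ‖f n ω - f 0 ω‖ *
        Real.exp (-(∑ j ∈ Finset.range n, w (j + 1) ω ^ 2) / 2)) μ ∧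
    ∀ A, MeasurableSet[ℱ n] A →
      ∫ ω in A, (Real.cosh ‖f (n + 1) ω - f 0 ω‖ *
        Real.exp (-(∑ j ∈ Finset.range (n + 1), w (j + 1) ω ^ 2) / 2)) ∂μ
      ≤ ∫ ω in A, (Real.cosh ‖f n ω - f 0 ω‖ *
        Real.exp (-(∑ j ∈ Finset.range n, w (j + 1) ω ^ 2) / 2)) ∂μ := by
  -- measurability and bounds
  have hbd : ∀ n : ℕ, ∀ᵐ ω ∂μ, ‖f n ω - f 0 ω‖ ≤ n * b := by
    intro n
    induction n with
    | zero => simp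
    | succ n ih =>
      filter_upwards [ih, hdom n, hwb n] with ω h1 h2 h3
      have : f (n + 1) ω - f 0 ω = (f (n + 1) ω - f n ω) + (f n ω - f 0 ω) := by abel
      rw [this]
      refine (norm_add_le _ _).trans ?_
      push_cast
      linarith
  have hx : ∀ n, StronglyMeasurable[ℱ n] (fun ω => f n ω - f 0 ω) := fun n =>
    (hf.stronglyMeasurable n).sub ((hf.stronglyMeasurable 0).mono (ℱ.mono (Nat.zero_le n)))
  have hW : ∀ n k, n ≤ k + 1 → StronglyMeasurable[ℱ k]
      (fun ω => Real.exp (-(∑ j ∈ Finset.range n, w (j + 1) ω ^ 2) / 2)) := by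
    intro n k hnk
    have h1 : StronglyMeasurable[ℱ k] (fun ω => ∑ j ∈ Finset.range n, w (j + 1) ω ^ 2) := by
      refine Finset.stronglyMeasurable_fun_sum _ fun j hj => ?_
      have := Finset.mem_range.1 hj
      exact ((hw_pred j).mono (ℱ.mono (by omega))).pow 2
    exact (show Continuous (fun y : ℝ => Real.exp (-y / 2)) by fun_prop).comp_stronglyMeasurable h1
  have hE : ∀ n ω, Real.exp (-(∑ j ∈ Finset.range n, w (j + 1) ω ^ 2) / 2) ≤ 1 := by
    intro n ω
    rw [Real.exp_le_one_iff]
    have : 0 ≤ ∑ j ∈ Finset.range n, w (j + 1) ω ^ 2 := Finset.sum_nonneg fun _ _ => sq_nonneg _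
    linarith
  have hint : ∀ n, Integrable (fun ω => Real.cosh ‖f n ω - f 0 ω‖ *
        Real.exp (-(∑ j ∈ Finset.range n, w (j + 1) ω ^ 2) / 2)) μ := by
    intro n
    have hsm : StronglyMeasurable[ℱ n] (fun ω => Real.cosh ‖f n ω - f 0 ω‖ *
        Real.exp (-(∑ j ∈ Finset.range n, w (j + 1) ω ^ 2) / 2)) :=
      (Real.continuous_cosh.comp_stronglyMeasurable (hx n).norm).mul (hW n n (by omega))
    refine Integrable.of_bound (hsm.mono (ℱ.le n)).aestronglyMeasurable (Real.cosh (n * b)) ?_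
    filter_upwards [hbd n] with ω h
    rw [norm_mul, Real.norm_of_nonneg (Real.cosh_pos _).le, Real.norm_of_nonneg (Real.exp_pos _).le]
    have h1 : Real.cosh ‖f n ω - f 0 ω‖ ≤ Real.cosh (n * b) :=
      Real.cosh_le_cosh.2 (by rw [abs_of_nonneg (norm_nonneg _)]; exact h.trans (le_abs_self _))
    calc _ ≤ Real.cosh (n * b) * 1 := by
          exact mul_le_mul h1 (hE n ω) (Real.exp_pos _).le (Real.cosh_pos _).le
      _ = _ := mul_one _
  refine ⟨hint n, fun A hA => ?_⟩
  set U : Ω → H := fun ω => Real.exp (-(∑ j ∈ Finset.range (n + 1), w (j + 1) ω ^ 2) / 2) •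
    ((Real.sinh ‖f n ω - f 0 ω‖ * Real.sinh (w (n + 1) ω) / (‖f n ω - f 0 ω‖ * w (n + 1) ω)) •
      (f n ω - f 0 ω)) with hU
  have hUm : StronglyMeasurable[ℱ n] U := by
    refine (hW (n + 1) n le_rfl).smul (StronglyMeasurable.smul ?_ (hx n))
    refine StronglyMeasurable.div ?_ ?_
    · exact (Real.continuous_sinh.comp_stronglyMeasurable (hx n).norm).mul
        (Real.continuous_sinh.comp_stronglyMeasurable (hw_pred n))
    · exact (hx n).norm.mul (hw_pred n)
  have hdint : Integrable (fun ω => f (n + 1) ω - f n ω) μ :=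
    (hf.integrable (n + 1)).sub (hf.integrable n)
  have hd0 : μ[(fun ω => f (n + 1) ω - f n ω) | ℱ n] =ᵐ[μ] 0 := by
    refine (condExp_sub (hf.integrable (n + 1)) (hf.integrable n) _).trans ?_
    filter_upwards [hf.condExp_ae_eq (Nat.le_succ n), hf.condExp_ae_eq (le_refl n)] with ω h1 h2
    simp [h1, h2]
  have hUd : Integrable (fun ω => (inner ℝ (U ω) (f (n + 1) ω - f n ω) : ℝ)) μ := by
    refine Integrable.of_bound (((hUm.mono (ℱ.le n)).aestronglyMeasurable).inner
      hdint.aestronglyMeasurable) (Real.sinh (n * b) * Real.sinh b) ?_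
    filter_upwards [hbd n, hdom n, hwb n] with ω h1 h2 h3
    have h4 := norm_coef (f n ω - f 0 ω) (f (n + 1) ω - f n ω) h2
    have h5 : 0 ≤ w (n + 1) ω := (norm_nonneg _).trans h2
    rw [hU]
    simp only
    rw [real_inner_smul_left, norm_mul, Real.norm_of_nonneg (Real.exp_pos _).le, Real.norm_eq_abs]
    refine (mul_le_of_le_one_left (abs_nonneg _) (hE _ _)).trans (h4.trans ?_)
    have h6 := Real.sinh_le_sinh.2 h1
    have h7 := Real.sinh_le_sinh.2 h3
    have h8 := Real.sinh_nonneg_iff.2 h5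
    have h9 := Real.sinh_nonneg_iff.2 (norm_nonneg (f n ω - f 0 ω))
    exact mul_le_mul h6 h7 h8 (h9.trans h6)
  have hz := integral_inner_zero (ℱ.le n) hUm hdint hd0 hUd hA
  calc _ ≤ ∫ ω in A, (Real.cosh ‖f n ω - f 0 ω‖ *
        Real.exp (-(∑ j ∈ Finset.range n, w (j + 1) ω ^ 2) / 2)
        + inner ℝ (U ω) (f (n + 1) ω - f n ω)) ∂μ := by
        refine setIntegral_mono_ae (hint (n + 1)).integrableOn
          ((hint n).add hUd).integrableOn ?_
        filter_upwards [hdom n] with ω h1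
        have h2 := cosh_norm_add (f n ω - f 0 ω) (f (n + 1) ω - f n ω) h1
        have e1 : f n ω - f 0 ω + (f (n + 1) ω - f n ω) = f (n + 1) ω - f 0 ω := by abel
        rw [e1] at h2
        have h3 := Real.cosh_le_exp_half_sq (w (n + 1) ω)
        rw [hU]
        simp only
        rw [real_inner_smul_left]
        have h4 : Real.exp (-(∑ j ∈ Finset.range n, w (j + 1) ω ^ 2) / 2)
            = Real.exp (-(∑ j ∈ Finset.range (n + 1), w (j + 1) ω ^ 2) / 2)
              * Real.exp (w (n + 1) ω ^ 2 / 2) := by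
          rw [← Real.exp_add, Finset.sum_range_succ]; congr 1; ring
        rw [h4]
        have h5 := Real.exp_pos (-(∑ j ∈ Finset.range (n + 1), w (j + 1) ω ^ 2) / 2)
        have h6 := mul_le_mul_of_nonneg_right h2 h5.le
        have h7 := mul_le_mul_of_nonneg_left h3
          (mul_pos (Real.cosh_pos ‖f n ω - f 0 ω‖) h5).le
        linarith
    _ = _ := by
        rw [integral_add (hint n).integrableOn hUd.integrableOn, hz, add_zero]

lemma azuma_core
    (ℱ : Filtration ℕ m) (f : ℕ → Ω → H) (hf : Martingale f ℱ μ)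
    (w : ℕ → Ω → ℝ)
    (hw_pred : ∀ j : ℕ, StronglyMeasurable[ℱ j] (w (j + 1)))
    (hdom : ∀ j : ℕ, ∀ᵐ ω ∂μ, ‖f (j + 1) ω - f j ω‖ ≤ w (j + 1) ω)
    (b : ℝ) (hW : ∀ n, ∀ᵐ ω ∂μ, ∑ j ∈ Finset.range n, w (j + 1) ω ^ 2 ≤ b)
    (ρ : ℝ) (hρ : 0 < ρ) (n : ℕ) :
    μ.real {ω | ∃ k ≤ n, ρ ≤ ‖f k ω - f 0 ω‖} ≤ Real.exp (b / 2) / Real.cosh ρ := by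
  have hwb : ∀ j, ∀ᵐ ω ∂μ, w (j + 1) ω ≤ √b := by
    intro j
    filter_upwards [hW (j + 1)] with ω h
    refine Real.le_sqrt_of_sq_le (le_trans ?_ h)
    exact Finset.single_le_sum (f := fun j => w (j + 1) ω ^ 2) (fun _ _ => sq_nonneg _)
      (Finset.self_mem_range_succ j)
  have hstep := azuma_step ℱ f hf w hw_pred hdom _ hwb
  set M : ℕ → Ω → ℝ := fun n ω => Real.cosh ‖f n ω - f 0 ω‖ *
        Real.exp (-(∑ j ∈ Finset.range n, w (j + 1) ω ^ 2) / 2) with hM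
  set B : ℕ → Set Ω := fun n => {ω | ∃ k ≤ n, ρ ≤ ‖f k ω - f 0 ω‖} with hB
  set c : ℝ := Real.cosh ρ * Real.exp (-b / 2) with hc
  have hBF : ∀ n, MeasurableSet[ℱ n] (B n) := by
    intro n
    have : B n = ⋃ k ∈ Set.Iic n, {ω | ρ ≤ ‖f k ω - f 0 ω‖} := by
      ext ω; simp [hB]
    rw [this]
    refine MeasurableSet.biUnion (Set.to_countable _) fun k hk => ?_
    have hx : StronglyMeasurable[ℱ n] (fun ω => f k ω - f 0 ω) :=
      ((hf.stronglyMeasurable k).mono (ℱ.mono hk)).sub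
        ((hf.stronglyMeasurable 0).mono (ℱ.mono (Nat.zero_le n)))
    exact @measurableSet_le _ _ _ _ _ (_) _ _ _ _ _ measurable_const hx.norm.measurable
  have hBm : ∀ n, MeasurableSet (B n) := fun n => ℱ.le n _ (hBF n)
  have hmono : ∀ n, B n ⊆ B (n + 1) := fun n ω ⟨k, hk, h⟩ => ⟨k, by omega, h⟩
  have key : ∀ n, c * μ.real (B n) + ∫ ω in (B n)ᶜ, M n ω ∂μ ≤ 1 := by
    intro n
    induction n with
    | zero =>
      have h0 : B 0 = ∅ := by
        ext ω; simp [hB, hρ]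
      simp [h0, hM]
    | succ n ih =>
      refine le_trans ?_ ih
      have h1 := (hstep n).2 (B n)ᶜ (hBF n).compl
      have h2 := integral_inter_add_sdiff (μ := μ) (s := (B n)ᶜ) (f := M (n + 1)) (hBm (n + 1))
        (hstep (n + 1)).1.integrableOn
      have e1 : (B n)ᶜ \ B (n + 1) = (B (n + 1))ᶜ := by
        ext ω; simp only [Set.mem_sdiff, Set.mem_compl_iff]
        exact ⟨fun h => h.2, fun h => ⟨fun h' => h (hmono n h'), h⟩⟩
      have e2 : (B n)ᶜ ∩ B (n + 1) = B (n + 1) \ B n := by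
        ext ω; simp [and_comm]
      rw [e1, e2] at h2
      have h3 : μ.real (B (n + 1) \ B n) = μ.real (B (n + 1)) - μ.real (B n) :=
        measureReal_sdiff (hmono n) (hBm n)
      have h4 : c * μ.real (B (n + 1) \ B n) ≤ ∫ ω in B (n + 1) \ B n, M (n + 1) ω ∂μ := by
        have : ∫ _ in B (n + 1) \ B n, c ∂μ = c * μ.real (B (n + 1) \ B n) := by
          rw [setIntegral_const, smul_eq_mul, mul_comm]
        rw [← this]
        refine setIntegral_mono_on_ae (integrable_const c).integrableOn
          (hstep (n + 1)).1.integrableOn ((hBm _).diff (hBm _)) ?_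
        filter_upwards [hW (n + 1)] with ω h5 h6
        obtain ⟨⟨k, hk, hk2⟩, h7⟩ := h6
        have hkn : k = n + 1 := by
          by_contra hne
          exact h7 ⟨k, by omega, hk2⟩
        subst hkn
        have h8 : Real.cosh ρ ≤ Real.cosh ‖f (n + 1) ω - f 0 ω‖ :=
          Real.cosh_le_cosh.2 (by
            rw [abs_of_nonneg (norm_nonneg _), abs_of_pos hρ]; exact hk2)
        have h9 : Real.exp (-b / 2) ≤
            Real.exp (-(∑ j ∈ Finset.range (n + 1), w (j + 1) ω ^ 2) / 2) :=
          Real.exp_le_exp.2 (by linarith)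
        exact mul_le_mul h8 h9 (Real.exp_pos _).le (Real.cosh_pos _).le
      rw [h3] at h4
      linarith
  have h1 : 0 ≤ ∫ ω in (B n)ᶜ, M n ω ∂μ :=
    integral_nonneg fun ω => (mul_pos (Real.cosh_pos _) (Real.exp_pos _)).le
  have h2 : c * μ.real (B n) ≤ 1 := by linarith [key n]
  rw [le_div_iff₀ (Real.cosh_pos _)]
  have h3 : Real.exp (b / 2) * Real.exp (-b / 2) = 1 := by
    rw [← Real.exp_add]; simp [← add_div]
  have h4 := mul_le_mul_of_nonneg_left h2 (Real.exp_pos (b / 2)).le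
  calc _ = (Real.exp (b / 2) * Real.exp (-b / 2)) * (μ.real (B n) * Real.cosh ρ) := by
        rw [h3, one_mul]
    _ = Real.exp (b / 2) * (c * μ.real (B n)) := by rw [hc]; ring
    _ ≤ _ := by linarith
end core

theorem azuma_hilbert_predictable
    {Ω H : Type*} {m : MeasurableSpace Ω} {μ : Measure Ω} [IsProbabilityMeasure μ]
    [NormedAddCommGroup H] [InnerProductSpace ℝ H] [CompleteSpace H]
    [TopologicalSpace.SeparableSpace H]
    (ℱ : Filtration ℕ m) (hℱ0 : ℱ 0 = ⊥)
    (f : ℕ → Ω → H) (hf : Martingale f ℱ μ)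
    (w : ℕ → Ω → ℝ)
    (hw_nonneg : ∀ j ω, 0 ≤ w (j + 1) ω)
    (hw_pred : ∀ j : ℕ, StronglyMeasurable[ℱ j] (w (j + 1)))
    (hdom : ∀ j : ℕ, ∀ᵐ ω ∂μ, ‖f (j + 1) ω - f j ω‖ ≤ w (j + 1) ω)
    (b : ℝ)
    (hb : essSup (fun ω => ∑' j : ℕ, ENNReal.ofReal (w (j + 1) ω ^ 2)) μ ≤ ENNReal.ofReal b)
    (r : ℝ) (hr : 0 < r) :
    μ {ω | ENNReal.ofReal r ≤ ⨆ j : ℕ, (‖f (j + 1) ω - f 0 ω‖₊ : ℝ≥0∞)}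
      ≤ ENNReal.ofReal (2 * Real.exp (-(r ^ 2) / (2 * b))) := by
  rcases le_or_gt b 0 with hb0 | hb0
  · refine prob_le_one.trans ?_
    rw [ENNReal.one_le_ofReal]
    have : 0 ≤ -(r ^ 2) / (2 * b) :=
      div_nonneg_of_nonpos (by nlinarith) (by linarith)
    linarith [Real.one_le_exp this]
  have hW : ∀ n, ∀ᵐ ω ∂μ, ∑ j ∈ Finset.range n, w (j + 1) ω ^ 2 ≤ b := by
    intro n
    filter_upwards [ENNReal.ae_le_essSup (μ := μ)
      (fun ω => ∑' j : ℕ, ENNReal.ofReal (w (j + 1) ω ^ 2))] with ω h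
    have h1 := (ENNReal.sum_le_tsum (Finset.range n)).trans (h.trans hb)
    rw [← ENNReal.ofReal_sum_of_nonneg (fun _ _ => sq_nonneg _)] at h1
    exact (ENNReal.ofReal_le_ofReal_iff hb0.le).1 h1
  set l : ℝ := r / b with hl
  have hl0 : 0 < l := div_pos hr hb0
  have hcore : ∀ ρ, 0 < ρ → ∀ n, μ.real {ω | ∃ k ≤ n, ρ ≤ ‖f k ω - f 0 ω‖}
      ≤ 2 * Real.exp (l ^ 2 * b / 2 - l * ρ) := by
    intro ρ hρ n
    have h := azuma_core ℱ (l • f) (hf.smul l) (fun j ω => l * w j ω)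
      (fun j => (hw_pred j).const_mul l)
      (fun j => by
        filter_upwards [hdom j] with ω h
        simp only [Pi.smul_apply]
        rw [← smul_sub, norm_smul, Real.norm_of_nonneg hl0.le]
        gcongr) (l ^ 2 * b)
      (fun n => by
        filter_upwards [hW n] with ω h
        simp only [mul_pow]
        rw [← Finset.mul_sum]
        gcongr) (l * ρ) (mul_pos hl0 hρ) n
    have hset : {ω | ∃ k ≤ n, l * ρ ≤ ‖(l • f) k ω - (l • f) 0 ω‖}
        = {ω | ∃ k ≤ n, ρ ≤ ‖f k ω - f 0 ω‖} := by
      ext ω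
      simp only [Set.mem_ofPred_eq, Pi.smul_apply]
      simp only [← smul_sub, norm_smul, Real.norm_of_nonneg hl0.le, mul_le_mul_iff_right₀ hl0]
    rw [hset] at h
    refine h.trans ?_
    rw [div_le_iff₀ (Real.cosh_pos _), sub_eq_add_neg, Real.exp_add, Real.cosh_eq]
    have h1 : Real.exp (-(l * ρ)) * Real.exp (l * ρ) = 1 := by rw [← Real.exp_add]; simp
    have h2 := Real.exp_pos (l ^ 2 * b / 2)
    have h3 : 0 ≤ Real.exp (-(l * ρ)) * Real.exp (-(l * ρ)) := by positivity
    have h4 := mul_nonneg h2.le h3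
    calc _ = Real.exp (l ^ 2 * b / 2) * (Real.exp (-(l * ρ)) * Real.exp (l * ρ)) := by
          rw [h1, mul_one]
      _ ≤ _ := by linarith
  have hall : ∀ ρ, 0 < ρ → ρ < r →
      μ {ω | ENNReal.ofReal r ≤ ⨆ j : ℕ, (‖f (j + 1) ω - f 0 ω‖₊ : ℝ≥0∞)}
      ≤ ENNReal.ofReal (2 * Real.exp (l ^ 2 * b / 2 - l * ρ)) := by
    intro ρ hρ hρr
    have hsub : {ω | ENNReal.ofReal r ≤ ⨆ j : ℕ, (‖f (j + 1) ω - f 0 ω‖₊ : ℝ≥0∞)}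
        ⊆ ⋃ n : ℕ, {ω | ∃ k ≤ n, ρ ≤ ‖f k ω - f 0 ω‖} := by
      intro ω hω
      have h1 : ENNReal.ofReal ρ < ⨆ j : ℕ, (‖f (j + 1) ω - f 0 ω‖₊ : ℝ≥0∞) :=
        ((ENNReal.ofReal_lt_ofReal_iff hr).2 hρr).trans_le hω
      obtain ⟨j, hj⟩ := lt_iSup_iff.1 h1
      refine Set.mem_iUnion.2 ⟨j + 1, j + 1, le_rfl, ?_⟩
      have h2 : (‖f (j + 1) ω - f 0 ω‖₊ : ℝ≥0∞) = ENNReal.ofReal ‖f (j + 1) ω - f 0 ω‖ :=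
        (ofReal_norm _).symm
      rw [h2] at hj
      exact (ENNReal.lt_ofReal_iff_toReal_lt ENNReal.ofReal_ne_top |>.1 hj |>.le |>
        fun h => by rwa [ENNReal.toReal_ofReal hρ.le] at h)
    refine (measure_mono hsub).trans ?_
    have hmono : Monotone (fun n : ℕ => {ω | ∃ k ≤ n, ρ ≤ ‖f k ω - f 0 ω‖}) :=
      fun a b hab ω ⟨k, hk, h⟩ => ⟨k, hk.trans hab, h⟩
    rw [hmono.measure_iUnion]
    refine iSup_le fun n => ?_
    rw [← ofReal_measureReal]
    exact ENNReal.ofReal_le_ofReal (hcore ρ hρ n)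
  have hlim : Filter.Tendsto (fun ρ : ℝ => ENNReal.ofReal (2 * Real.exp (l ^ 2 * b / 2 - l * ρ)))
      (nhdsWithin r (Set.Iio r)) (nhds (ENNReal.ofReal (2 * Real.exp (l ^ 2 * b / 2 - l * r)))) := by
    have : Continuous (fun ρ : ℝ => ENNReal.ofReal (2 * Real.exp (l ^ 2 * b / 2 - l * ρ))) :=
      ENNReal.continuous_ofReal.comp (by fun_prop)
    exact this.continuousAt.mono_left nhdsWithin_le_nhds
  have hfin := ge_of_tendsto hlim (by
    filter_upwards [Ioo_mem_nhdsLT hr] with ρ h using hall ρ h.1 h.2)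
  have he : -(r ^ 2) / (2 * b) = l ^ 2 * b / 2 - l * r := by
    rw [hl]
    field_simp
    ring
  rw [he]
  exact hfin
end

section
/- Let H be a separable Hilbert space and let f = (f_j)_{j≥0} be an H-valued martingale relative to a filtration (F_j)_{j≥0} with F_0 trivial, and suppose there exists a nonnegative predictable sequence w = (w_j)_{j≥1} with ‖d_j‖ ≤ w_j almost surely for every j ≥ 1. Then for every λ > 0 and every j ≥ 1, one has E[cosh(λ‖f_j‖) | F_{j−1}] ≤ exp(λ²·w_j²/2)·cosh(λ‖f_{j−1}‖) almost surely; consequently, the sequence g_n = cosh(λ‖f_n‖) / Π_{j=1}^n exp(λ²w_j²/2) is a nonnegative supermartingale relative to (F_j). -/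
open MeasureTheory
open scoped ENNReal NNReal

lemma cosh_sq_convex (p q r t : ℝ) (ht0 : 0 ≤ t) (ht1 : t ≤ 1)
    (h : r ^ 2 ≤ (1 - t) * p ^ 2 + t * q ^ 2) :
    Real.cosh r ≤ (1 - t) * Real.cosh p + t * Real.cosh q := by
  refine hasSum_le (fun n => ?_) (Real.hasSum_cosh r)
    (((Real.hasSum_cosh p).mul_left (1 - t)).add ((Real.hasSum_cosh q).mul_left t))
  have h1 : (r ^ 2) ^ n ≤ ((1 - t) * p ^ 2 + t * q ^ 2) ^ n :=
    pow_le_pow_left₀ (sq_nonneg r) h n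
  have h2 := (convexOn_pow n).2 (Set.mem_Ici.2 (sq_nonneg p)) (Set.mem_Ici.2 (sq_nonneg q))
    (sub_nonneg.2 ht1) ht0 (by ring)
  simp only [smul_eq_mul] at h2
  have h3 := h1.trans h2
  rw [pow_mul, pow_mul, pow_mul, ← mul_div_assoc, ← mul_div_assoc, ← add_div]
  gcongr

lemma cosh_norm_add_le {H : Type*} [NormedAddCommGroup H] [InnerProductSpace ℝ H]
    (x d : H) (w l : ℝ) (hl : 0 < l) (hd : ‖d‖ ≤ w) :
    Real.cosh (l * ‖x + d‖) ≤ Real.cosh (l * w) * Real.cosh (l * ‖x‖) +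
      inner ℝ ((Real.sinh (l * w) / w * (Real.sinh (l * ‖x‖) / ‖x‖)) • x) d := by
  have hw : 0 ≤ w := (norm_nonneg d).trans hd
  rcases eq_or_ne x 0 with rfl | hx
  · simp only [zero_add, norm_zero, mul_zero, Real.cosh_zero, mul_one, smul_zero, inner_zero_left,
      add_zero]
    rw [Real.cosh_le_cosh, abs_of_nonneg (by positivity), abs_of_nonneg (by positivity)]
    gcongr
  rcases hw.eq_or_lt with rfl | hw
  · have : d = 0 := by simpa using hd
    simp [this]
  have ha : 0 < ‖x‖ := norm_pos_iff.2 hx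
  have hs : |inner ℝ x d| ≤ ‖x‖ * w :=
    (abs_real_inner_le_norm x d).trans (by gcongr)
  rw [abs_le] at hs
  rw [real_inner_smul_left]
  have hsq := norm_add_sq_real x d
  have hd2 : ‖d‖ ^ 2 ≤ w ^ 2 := by gcongr
  set s : ℝ := inner ℝ x d
  set a := ‖x‖
  have haw : 0 < a * w := by positivity
  have key := cosh_sq_convex (l * a - l * w) (l * a + l * w) (l * ‖x + d‖)
    ((1 + s / (a * w)) / 2) ?_ ?_ ?_
  · rw [Real.cosh_sub, Real.cosh_add] at key
    refine key.trans (le_of_eq ?_)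
    field_simp
    ring
  · have : -1 ≤ s / (a * w) := by rw [le_div_iff₀ haw]; linarith
    linarith
  · have : s / (a * w) ≤ 1 := by rw [div_le_iff₀ haw]; linarith
    linarith
  · have : (1 - (1 + s / (a * w)) / 2) * (l * a - l * w) ^ 2 +
        (1 + s / (a * w)) / 2 * (l * a + l * w) ^ 2 = l ^ 2 * (a ^ 2 + 2 * s + w ^ 2) := by
      field_simp
      ring
    rw [this, mul_pow, hsq]
    gcongr

section step

variable {Ω H : Type*} {m m0 : MeasurableSpace Ω} {μ : Measure Ω} [IsProbabilityMeasure μ]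
    [NormedAddCommGroup H] [InnerProductSpace ℝ H] [CompleteSpace H]

lemma step_aux (hm : m ≤ m0) {Y G : Ω → ℝ} {V d : Ω → H}
    (hY : AEStronglyMeasurable Y μ) (hY0 : ∀ ω, 0 ≤ Y ω)
    (hG : StronglyMeasurable[m] G) (hG0 : ∀ ω, 0 ≤ G ω)
    (hV : StronglyMeasurable[m] V) (hd : Integrable d μ) (hd0 : μ[d | m] =ᵐ[μ] 0)
    (h : ∀ᵐ ω ∂μ, Y ω ≤ G ω + inner ℝ (V ω) (d ω)) (n : ℕ)
    (A : Set Ω) (hA : A = {ω | ‖V ω‖ ≤ n ∧ G ω ≤ n}) :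
    MeasurableSet[m] A ∧ Integrable (A.indicator G) μ ∧ Integrable (A.indicator Y) μ ∧
      μ[A.indicator Y | m] ≤ᵐ[μ] A.indicator G := by
  have hAm : MeasurableSet[m] A := by
    rw [hA]
    exact (measurableSet_le hV.norm.measurable measurable_const).inter
      (measurableSet_le hG.measurable measurable_const)
  have hGi : Integrable (A.indicator G) μ := by
    refine Integrable.of_bound ((hG.indicator hAm).mono hm).aestronglyMeasurable (n : ℝ) ?_
    refine .of_forall fun ω => ?_
    by_cases hω : ω ∈ A
    · rw [Set.indicator_of_mem hω, Real.norm_of_nonneg (hG0 ω)]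
      rw [hA] at hω
      exact hω.2
    · simp [hω]
  have hVA : StronglyMeasurable[m] (A.indicator V) := hV.indicator hAm
  have hVd : Integrable (fun ω => inner ℝ (A.indicator V ω) (d ω)) μ := by
    refine Integrable.mono' (hd.norm.const_mul (n : ℝ))
      ((hVA.mono hm).aestronglyMeasurable.inner hd.1) ?_
    refine .of_forall fun ω => (norm_inner_le_norm _ _).trans ?_
    gcongr
    by_cases hω : ω ∈ A
    · rw [Set.indicator_of_mem hω]
      rw [hA] at hω
      exact hω.1
    · simp [hω]
  have hle : A.indicator Y ≤ᵐ[μ]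
      A.indicator G + fun ω => inner ℝ (A.indicator V ω) (d ω) := by
    filter_upwards [h] with ω hω
    by_cases hω' : ω ∈ A
    · simpa [hω'] using hω
    · simp [hω']
  have hYi : Integrable (A.indicator Y) μ := by
    refine Integrable.mono' (hGi.add hVd) (hY.indicator (hm _ hAm)) ?_
    filter_upwards [hle] with ω hω
    rwa [Real.norm_of_nonneg (Set.indicator_nonneg (fun ω _ => hY0 ω) ω)]
  refine ⟨hAm, hGi, hYi, ?_⟩
  have h1 := condExp_mono (m := m) hYi (hGi.add hVd) hle
  have h2 := condExp_add (m := m) hGi hVd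
  have h3 : μ[fun ω => inner ℝ (A.indicator V ω) (d ω) | m] =ᵐ[μ]
      fun ω => inner ℝ (A.indicator V ω) (μ[d | m] ω) :=
    condExp_bilin_of_stronglyMeasurable_left (m := m) (innerSL ℝ) hVA hVd hd
  have h4 : μ[A.indicator G | m] = A.indicator G :=
    condExp_of_stronglyMeasurable hm (hG.indicator hAm) hGi
  filter_upwards [h1, h2, h3, hd0] with ω h1 h2 h3 h0
  simp only [h0, Pi.zero_apply, inner_zero_right] at h3
  rw [h2, Pi.add_apply, h3, h4, add_zero] at h1
  exact h1

lemma step_integrable (hm : m ≤ m0) {Y G : Ω → ℝ} {V d : Ω → H}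
    (hY : AEStronglyMeasurable Y μ) (hY0 : ∀ ω, 0 ≤ Y ω)
    (hG : StronglyMeasurable[m] G) (hG0 : ∀ ω, 0 ≤ G ω)
    (hV : StronglyMeasurable[m] V) (hd : Integrable d μ) (hd0 : μ[d | m] =ᵐ[μ] 0)
    (h : ∀ᵐ ω ∂μ, Y ω ≤ G ω + inner ℝ (V ω) (d ω)) (hGi : Integrable G μ) :
    Integrable Y μ := by
  have key := fun n => step_aux hm hY hY0 hG hG0 hV hd hd0 h n _ rfl
  have hc : AECover μ Filter.atTop (fun n : ℕ => {ω | ‖V ω‖ ≤ n ∧ G ω ≤ n}) := by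
    refine ⟨.of_forall fun ω => ?_, fun n => hm _ (key n).1⟩
    filter_upwards [Filter.eventually_ge_atTop ⌈‖V ω‖⌉₊, Filter.eventually_ge_atTop ⌈G ω⌉₊]
      with n h1 h2
    exact ⟨Nat.ceil_le.1 h1, Nat.ceil_le.1 h2⟩
  refine hc.integrable_of_integral_bounded_of_nonneg_ae (∫ ω, G ω ∂μ) (fun n => ?_)
    (.of_forall hY0) (.of_forall fun n => ?_)
  · rw [← integrable_indicator_iff (hm _ (key n).1)]
    exact (key n).2.2.1
  · obtain ⟨k1, k2, k3, k4⟩ := key n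
    rw [← integral_indicator (hm _ k1), ← integral_condExp hm]
    refine (integral_mono_ae integrable_condExp k2 k4).trans ?_
    exact integral_mono k2 hGi (Set.indicator_le_self' fun ω _ => hG0 ω)

lemma step_condExp (hm : m ≤ m0) {Y G : Ω → ℝ} {V d : Ω → H}
    (hY : AEStronglyMeasurable Y μ) (hY0 : ∀ ω, 0 ≤ Y ω)
    (hG : StronglyMeasurable[m] G) (hG0 : ∀ ω, 0 ≤ G ω)
    (hV : StronglyMeasurable[m] V) (hd : Integrable d μ) (hd0 : μ[d | m] =ᵐ[μ] 0)
    (h : ∀ᵐ ω ∂μ, Y ω ≤ G ω + inner ℝ (V ω) (d ω)) :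
    μ[Y | m] ≤ᵐ[μ] G := by
  by_cases hYi : Integrable Y μ
  swap
  · rw [condExp_of_not_integrable hYi]
    exact .of_forall hG0
  have key := fun n => step_aux hm hY hY0 hG hG0 hV hd hd0 h n _ rfl
  have k4 := ae_all_iff.2 fun n => (key n).2.2.2
  have k5 := ae_all_iff.2 fun n => condExp_indicator hYi (key n).1
  filter_upwards [k4, k5] with ω h4 h5
  have hω : ω ∈ {ω | ‖V ω‖ ≤ (max ⌈‖V ω‖⌉₊ ⌈G ω⌉₊ : ℕ) ∧ G ω ≤ (max ⌈‖V ω‖⌉₊ ⌈G ω⌉₊ : ℕ)} :=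
    ⟨Nat.ceil_le.1 (le_max_left _ _), Nat.ceil_le.1 (le_max_right _ _)⟩
  specialize h4 (max ⌈‖V ω‖⌉₊ ⌈G ω⌉₊)
  specialize h5 (max ⌈‖V ω‖⌉₊ ⌈G ω⌉₊)
  rw [h5, Set.indicator_of_mem (by exact hω), Set.indicator_of_mem (by exact hω)] at h4
  exact h4

end step

theorem cosh_supermartingale_hilbert
    {Ω H : Type*} {m : MeasurableSpace Ω} {μ : Measure Ω} [IsProbabilityMeasure μ]
    [NormedAddCommGroup H] [InnerProductSpace ℝ H] [CompleteSpace H]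
    [TopologicalSpace.SeparableSpace H]
    (ℱ : Filtration ℕ m) (hℱ0 : ℱ 0 = ⊥)
    (f : ℕ → Ω → H) (hf : Martingale f ℱ μ)
    (w : ℕ → Ω → ℝ)
    (hw_nonneg : ∀ j ω, 0 ≤ w (j + 1) ω)
    (hw_pred : ∀ j : ℕ, StronglyMeasurable[ℱ j] (w (j + 1)))
    (hdom : ∀ j : ℕ, ∀ᵐ ω ∂μ, ‖f (j + 1) ω - f j ω‖ ≤ w (j + 1) ω)
    (l : ℝ) (hl : 0 < l) :
    (∀ j : ℕ,
      (μ[fun ω => Real.cosh (l * ‖f (j + 1) ω‖) | ℱ j]) ≤ᵐ[μ]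
        fun ω => Real.exp (l ^ 2 * w (j + 1) ω ^ 2 / 2) * Real.cosh (l * ‖f j ω‖)) ∧
    Supermartingale
      (fun n ω => Real.cosh (l * ‖f n ω‖) /
        ∏ j ∈ Finset.range n, Real.exp (l ^ 2 * w (j + 1) ω ^ 2 / 2)) ℱ μ := by
  have hd : ∀ j, Integrable (fun ω => f (j + 1) ω - f j ω) μ := fun j =>
    (hf.integrable (j + 1)).sub (hf.integrable j)
  have hd0 : ∀ j, μ[fun ω => f (j + 1) ω - f j ω | ℱ j] =ᵐ[μ] 0 := fun j => by
    have h1 := condExp_sub (hf.integrable (j + 1)) (hf.integrable j) (ℱ j)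
    filter_upwards [h1, hf.2 j (j + 1) (Nat.le_succ j), hf.2 j j le_rfl] with ω h1 h2 h3
    refine Eq.trans h1 ?_
    rw [Pi.sub_apply, h2, h3, sub_self, Pi.zero_apply]
  have hcosh : ∀ j, StronglyMeasurable[ℱ j] (fun ω => Real.cosh (l * ‖f j ω‖)) := fun j =>
    Real.continuous_cosh.comp_stronglyMeasurable ((hf.1 j).norm.const_mul l)
  have hexp : ∀ j, StronglyMeasurable[ℱ j] (fun ω => Real.exp (l ^ 2 * w (j + 1) ω ^ 2 / 2)) :=
    fun j => (by fun_prop : Continuous fun x : ℝ => Real.exp (l ^ 2 * x ^ 2 / 2)).comp_stronglyMeasurable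
      (hw_pred j)
  let V : ℕ → Ω → H := fun j ω =>
    (Real.sinh (l * w (j + 1) ω) / w (j + 1) ω * (Real.sinh (l * ‖f j ω‖) / ‖f j ω‖)) • f j ω
  have hV : ∀ j, StronglyMeasurable[ℱ j] (V j) := fun j => by
    have e1 : Measurable fun x : ℝ => Real.sinh (l * x) / x :=
      (Real.continuous_sinh.measurable.comp (measurable_const_mul l)).div measurable_id
    exact ((e1.comp (hw_pred j).measurable).stronglyMeasurable.mul
      (e1.comp (hf.1 j).norm.measurable).stronglyMeasurable).smul (hf.1 j)
  have hpt : ∀ j, ∀ᵐ ω ∂μ, Real.cosh (l * ‖f (j + 1) ω‖) ≤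
      Real.exp (l ^ 2 * w (j + 1) ω ^ 2 / 2) * Real.cosh (l * ‖f j ω‖) +
        inner ℝ (V j ω) (f (j + 1) ω - f j ω) := fun j => by
    filter_upwards [hdom j] with ω hω
    have h1 := cosh_norm_add_le (f j ω) (f (j + 1) ω - f j ω) (w (j + 1) ω) l hl hω
    rw [add_sub_cancel] at h1
    refine h1.trans ?_
    have h2 := Real.cosh_le_exp_half_sq (l * w (j + 1) ω)
    rw [mul_pow] at h2
    have h3 := (Real.cosh_pos (l * ‖f j ω‖)).le
    gcongr
  let P : ℕ → Ω → ℝ := fun n ω => ∏ j ∈ Finset.range n, Real.exp (l ^ 2 * w (j + 1) ω ^ 2 / 2)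
  have hPpos : ∀ n ω, 0 < P n ω := fun n ω => Finset.prod_pos fun i _ => Real.exp_pos _
  have hPs : ∀ n ω, P (n + 1) ω = P n ω * Real.exp (l ^ 2 * w (n + 1) ω ^ 2 / 2) := fun n ω =>
    Finset.prod_range_succ _ _
  have hPm : ∀ n, StronglyMeasurable[ℱ n] (P (n + 1)) := fun n =>
    Finset.stronglyMeasurable_fun_prod _ fun i hi =>
      (hexp i).mono (ℱ.mono (Nat.lt_succ_iff.1 (Finset.mem_range.1 hi)))
  have hPm' : ∀ n, StronglyMeasurable[ℱ n] (P n) := fun n =>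
    Finset.stronglyMeasurable_fun_prod _ fun i hi =>
      (hexp i).mono (ℱ.mono (Finset.mem_range.1 hi).le)
  have hgm : ∀ n, StronglyMeasurable[ℱ n] (fun ω => Real.cosh (l * ‖f n ω‖) / P n ω) := fun n =>
    ((hcosh n).measurable.div (hPm' n).measurable).stronglyMeasurable
  have hg0 : ∀ n ω, 0 ≤ Real.cosh (l * ‖f n ω‖) / P n ω := fun n ω =>
    div_nonneg (Real.cosh_pos _).le (hPpos n ω).le
  have hUm : ∀ n, StronglyMeasurable[ℱ n] (fun ω => (P (n + 1) ω)⁻¹ • V n ω) := fun n =>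
    (hPm n).measurable.inv.stronglyMeasurable.smul (hV n)
  have hpt2 : ∀ n, ∀ᵐ ω ∂μ, Real.cosh (l * ‖f (n + 1) ω‖) / P (n + 1) ω ≤
      Real.cosh (l * ‖f n ω‖) / P n ω +
        inner ℝ ((P (n + 1) ω)⁻¹ • V n ω) (f (n + 1) ω - f n ω) := fun n => by
    filter_upwards [hpt n] with ω hω
    have h1 := div_le_div_of_nonneg_right hω (hPpos (n + 1) ω).le
    refine h1.trans (le_of_eq ?_)
    rw [real_inner_smul_left (V n ω), add_div, hPs]
    have := (hPpos n ω).ne'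
    have := (Real.exp_pos (l ^ 2 * w (n + 1) ω ^ 2 / 2)).ne'
    congr 1
    · field_simp
    · rw [div_eq_inv_mul]
  refine ⟨fun j => ?_, supermartingale_nat hgm (fun n => ?_) fun n => ?_⟩
  · exact step_condExp (ℱ.le j) ((hcosh (j + 1)).mono (ℱ.le _)).aestronglyMeasurable
      (fun ω => (Real.cosh_pos _).le) ((hexp j).mul (hcosh j))
      (fun ω => mul_nonneg (Real.exp_pos _).le (Real.cosh_pos _).le) (hV j) (hd j) (hd0 j) (hpt j)
  · induction n with
    | zero =>
      have h0 := hf.1 0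
      rw [hℱ0] at h0
      obtain ⟨c, hc⟩ := stronglyMeasurable_bot_iff.1 h0
      simp [hc]
    | succ n ih =>
      exact step_integrable (ℱ.le n) ((hgm (n + 1)).mono (ℱ.le _)).aestronglyMeasurable
        (hg0 (n + 1)) (hgm n) (hg0 n) (hUm n) (hd n) (hd0 n) (hpt2 n) ih
  · exact step_condExp (ℱ.le n) ((hgm (n + 1)).mono (ℱ.le _)).aestronglyMeasurable
        (hg0 (n + 1)) (hgm n) (hg0 n) (hUm n) (hd n) (hd0 n) (hpt2 n)
end

section
/- Let X be a Banach space having Azuma type p with constant K (1 < p ≤ 2). Then for every X-valued dyadic martingale f = (f_j)_{j≥0} and every 1 ≤ r < ∞, one has E[(f*)^r] ≤ 4^{r+1}·((r+2)·(log 2)·K)^{r/p}·E[S_p(f)^r]. -/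
open MeasureTheory
open scoped ENNReal NNReal


/-- The σ-algebra on `ℝ` generated by the dyadic intervals of length `2^{-n}`. -/
def dyadicAlgebra (n : ℕ) : MeasurableSpace ℝ :=
  MeasurableSpace.generateFrom
    {s | ∃ k : ℤ, s = Set.Ico ((k : ℝ) / 2 ^ n) (((k : ℝ) + 1) / 2 ^ n)}

/-- The dyadic filtration on `ℝ`. -/
noncomputable def dyadicFiltration : Filtration ℕ (Real.measurableSpace) where
  seq := dyadicAlgebra
  mono' := monotone_nat_of_le_succ fun n => by
    refine MeasurableSpace.generateFrom_le ?_
    rintro s ⟨k, rfl⟩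
    have hab : ((2 * k : ℤ) : ℝ) / 2 ^ (n + 1) ≤ ((2 * k + 1 : ℤ) : ℝ) / 2 ^ (n + 1) := by
      gcongr
      push_cast; linarith
    have hbc : ((2 * k + 1 : ℤ) : ℝ) / 2 ^ (n + 1)
        ≤ (((2 * k + 1 : ℤ) : ℝ) + 1) / 2 ^ (n + 1) := by
      gcongr
      linarith
    have e1 : ((2 * k : ℤ) : ℝ) / 2 ^ (n + 1) = (k : ℝ) / 2 ^ n := by
      push_cast; field_simp; ring
    have e2 : (((2 * k + 1 : ℤ) : ℝ) + 1) / 2 ^ (n + 1) = ((k : ℝ) + 1) / 2 ^ n := by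
      push_cast; field_simp; ring
    have e3 : ((2 * k : ℤ) : ℝ) + 1 = ((2 * k + 1 : ℤ) : ℝ) := by push_cast; ring
    have key : Set.Ico ((k : ℝ) / 2 ^ n) (((k : ℝ) + 1) / 2 ^ n)
        = Set.Ico (((2 * k : ℤ) : ℝ) / 2 ^ (n + 1)) ((((2 * k : ℤ) : ℝ) + 1) / 2 ^ (n + 1))
        ∪ Set.Ico (((2 * k + 1 : ℤ) : ℝ) / 2 ^ (n + 1))
            ((((2 * k + 1 : ℤ) : ℝ) + 1) / 2 ^ (n + 1)) := by
      rw [e3, Set.Ico_union_Ico_eq_Ico hab hbc, e1, e2]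
    rw [key]
    exact MeasurableSet.union
      (MeasurableSpace.measurableSet_generateFrom (by exact ⟨2 * k, rfl⟩))
      (MeasurableSpace.measurableSet_generateFrom (by exact ⟨2 * k + 1, rfl⟩))
  le' := fun n => MeasurableSpace.generateFrom_le (by rintro s ⟨k, rfl⟩; exact measurableSet_Ico)

/-- A Banach space `X` has Azuma type `p` with constant `K` if for every `X`-valued
martingale `f` (on any filtered probability space with trivial initial σ-algebra) and every
nonnegative predictable sequence `w` dominating the martingale differences a.s., one has
`P(f* ≥ r) ≤ 2·exp(−r^p/(K·‖Σ_j w_j^p‖_∞))` for all `r > 0`. -/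
def HasAzumaType (X : Type*) [NormedAddCommGroup X] [NormedSpace ℝ X] [CompleteSpace X]
    (p K : ℝ) : Prop :=
  ∀ (Ω : Type) (m : MeasurableSpace Ω) (μ : Measure Ω), IsProbabilityMeasure μ →
    ∀ ℱ : Filtration ℕ m, ℱ 0 = ⊥ →
    ∀ f : ℕ → Ω → X, Martingale f ℱ μ →
    ∀ w : ℕ → Ω → ℝ, (∀ j ω, 0 ≤ w (j + 1) ω) →
      (∀ j : ℕ, StronglyMeasurable[ℱ j] (w (j + 1))) →
      (∀ j : ℕ, ∀ᵐ ω ∂μ, ‖f (j + 1) ω - f j ω‖ ≤ w (j + 1) ω) →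
      ∀ r : ℝ, 0 < r →
        μ {ω | ENNReal.ofReal r ≤ ⨆ j : ℕ, (‖f (j + 1) ω - f 0 ω‖₊ : ℝ≥0∞)}
          ≤ ENNReal.ofReal (2 * Real.exp (-(r ^ p) /
              (K * (essSup (fun ω => ∑' j : ℕ, ENNReal.ofReal (w (j + 1) ω ^ p)) μ).toReal)))

namespace DyAz

/-- index of the level-`n` dyadic interval containing `x` -/
noncomputable def ix (n : ℕ) (x : ℝ) : ℤ := ⌊(2 : ℝ) ^ n * x⌋

lemma ix_succ (n : ℕ) (x : ℝ) : ix (n + 1) x = 2 * ix n x ∨ ix (n + 1) x = 2 * ix n x + 1 := by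
  unfold ix
  set y := (2 : ℝ) ^ n * x with hy
  have h : (2 : ℝ) ^ (n + 1) * x = 2 * y := by rw [hy]; ring
  rw [h]
  have h1 := Int.floor_le y
  have h2 := Int.lt_floor_add_one y
  have h3 : 2 * ⌊y⌋ ≤ ⌊2 * y⌋ := by
    rw [Int.le_floor]; push_cast; linarith
  have h4 : ⌊2 * y⌋ < 2 * ⌊y⌋ + 2 := by
    rw [Int.floor_lt]; push_cast; linarith
  omega

lemma ix_succ_div (n : ℕ) (x : ℝ) : ix (n + 1) x / 2 = ix n x := by
  rcases ix_succ n x with h | h <;> omega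

lemma ix_preimage (n : ℕ) (k : ℤ) :
    ix n ⁻¹' {k} = Set.Ico ((k : ℝ) / 2 ^ n) (((k : ℝ) + 1) / 2 ^ n) := by
  ext x
  have h2 : (0 : ℝ) < 2 ^ n := by positivity
  simp only [ix, Set.mem_preimage, Set.mem_singleton_iff, Set.mem_Ico, Int.floor_eq_iff,
    div_le_iff₀ h2, lt_div_iff₀ h2, mul_comm]

lemma ix_measurable (n : ℕ) : Measurable[dyadicAlgebra n] (ix n) := by
  refine @measurable_to_countable' ℤ ℝ _ _ (dyadicAlgebra n) (ix n) fun k => ?_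
  rw [ix_preimage]
  exact MeasurableSpace.measurableSet_generateFrom ⟨k, rfl⟩

lemma dyadicAlgebra_eq (n : ℕ) : dyadicAlgebra n = MeasurableSpace.comap (ix n) ⊤ := by
  apply le_antisymm
  · refine MeasurableSpace.generateFrom_le ?_
    rintro s ⟨k, rfl⟩
    rw [← ix_preimage]
    exact ⟨{k}, trivial, rfl⟩
  · rw [← measurable_iff_comap_le]
    exact ix_measurable n

lemma ix_measurable' (n : ℕ) : Measurable (ix n) :=
  (ix_measurable n).mono (dyadicFiltration.le n) le_rfl

lemma ix_mem (n : ℕ) {x : ℝ} (hx : x ∈ Set.Ico (0 : ℝ) 1) : 0 ≤ ix n x ∧ ix n x < 2 ^ n := by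
  have h2 : (0 : ℝ) < 2 ^ n := by positivity
  constructor
  · exact Int.floor_nonneg.2 (mul_nonneg h2.le hx.1)
  · unfold ix
    rw [Int.floor_lt]
    push_cast
    nlinarith [hx.2]

lemma ix_zero {x : ℝ} (hx : x ∈ Set.Ico (0 : ℝ) 1) : ix 0 x = 0 := by
  have := ix_mem 0 hx
  simp at this
  omega

variable {X : Type*} [NormedAddCommGroup X] [NormedSpace ℝ X]

/-- the function of a tree -/
noncomputable def val (G : ℕ → ℤ → X) (n : ℕ) (x : ℝ) : X := G n (ix n x)

/-- averaging trees -/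
def Avg (G : ℕ → ℤ → X) : Prop :=
  ∀ n k, G n k + G n k = G (n + 1) (2 * k) + G (n + 1) (2 * k + 1)

lemma val_sm (G : ℕ → ℤ → X) (n : ℕ) : StronglyMeasurable[dyadicAlgebra n] (val G n) := by
  have h : StronglyMeasurable (G n) := StronglyMeasurable.of_discrete
  exact h.comp_measurable (ix_measurable n)

lemma val_sm' (G : ℕ → ℤ → X) (n : ℕ) : StronglyMeasurable (val G n) :=
  (val_sm G n).mono (dyadicFiltration.le n)

lemma diff_norm {G : ℕ → ℤ → X} (hG : Avg G) (n : ℕ) (x : ℝ) :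
    ‖val G (n + 1) x - val G n x‖ = ‖G (n + 1) (2 * ix n x) - G n (ix n x)‖ := by
  unfold val
  rcases ix_succ n x with h | h
  · rw [h]
  · rw [h, ← norm_neg]
    congr 1
    have := hG n (ix n x)
    rw [neg_sub, sub_eq_sub_iff_add_eq_add, this]

lemma val_integrable (G : ℕ → ℤ → X) (n : ℕ) :
    Integrable (val G n) (volume.restrict (Set.Ico (0 : ℝ) 1)) := by
  refine Integrable.of_bound (val_sm' G n).aestronglyMeasurable
    (∑ k ∈ Finset.Ico (0 : ℤ) (2 ^ n), ‖G n k‖) ?_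
  rw [ae_restrict_iff' measurableSet_Ico]
  refine ae_of_all _ fun x hx => ?_
  have := ix_mem n hx
  exact Finset.single_le_sum (f := fun k => ‖G n k‖) (fun _ _ => norm_nonneg _)
    (Finset.mem_Ico.2 this)

lemma setIntegral_cell [CompleteSpace X] (G : ℕ → ℤ → X) (n : ℕ) (k : ℤ) :
    ∫ x in ix n ⁻¹' {k}, val G n x = ((2 : ℝ) ^ n)⁻¹ • G n k := by
  have h : ∫ x in ix n ⁻¹' {k}, val G n x = ∫ x in ix n ⁻¹' {k}, G n k := by
    refine setIntegral_congr_fun (ix_measurable' n (measurableSet_singleton k)) ?_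
    intro x hx
    have : ix n x = k := hx
    simp [val, this]
  rw [h, setIntegral_const, ix_preimage, Real.volume_real_Ico_of_le (by gcongr; linarith)]
  congr 1
  field_simp
  ring

lemma cell_split (n : ℕ) (k : ℤ) :
    ix n ⁻¹' {k} = ix (n + 1) ⁻¹' {2 * k} ∪ ix (n + 1) ⁻¹' {2 * k + 1} := by
  ext x
  have := ix_succ n x
  simp only [Set.mem_preimage, Set.mem_singleton_iff, Set.mem_union]
  omega

lemma cell_sub (n : ℕ) (k : ℤ) (hk : 0 ≤ k ∧ k < 2 ^ n) :
    ix n ⁻¹' {k} ⊆ Set.Ico (0 : ℝ) 1 := by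
  rw [ix_preimage]
  have h2 : (0 : ℝ) < 2 ^ n := by positivity
  apply Set.Ico_subset_Ico
  · have : (0 : ℝ) ≤ k := by exact_mod_cast hk.1
    positivity
  · rw [div_le_one h2]
    have : k + 1 ≤ 2 ^ n := hk.2
    exact_mod_cast this

lemma setIntegral_cell_succ [CompleteSpace X] (G : ℕ → ℤ → X) (n : ℕ) (k : ℤ)
    (hk : 0 ≤ k ∧ k < 2 ^ n) :
    ∫ x in ix n ⁻¹' {k}, val G (n + 1) x
      = ((2 : ℝ) ^ (n + 1))⁻¹ • (G (n + 1) (2 * k) + G (n + 1) (2 * k + 1)) := by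
  have hi : IntegrableOn (val G (n + 1)) (ix n ⁻¹' {k}) :=
    IntegrableOn.mono_set (val_integrable G (n + 1)) (cell_sub n k hk)
  rw [cell_split] at hi ⊢
  rw [setIntegral_union _ (ix_measurable' _ (measurableSet_singleton _))
    hi.left_of_union hi.right_of_union, setIntegral_cell, setIntegral_cell, smul_add]
  refine Disjoint.preimage _ ?_
  simp

lemma setIntegral_eq_succ [CompleteSpace X] {G : ℕ → ℤ → X} (hG : Avg G) (n : ℕ) (s : Set ℝ)
    (hs : MeasurableSet[dyadicAlgebra n] s) :
    ∫ x in s, val G n x ∂(volume.restrict (Set.Ico (0 : ℝ) 1))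
      = ∫ x in s, val G (n + 1) x ∂(volume.restrict (Set.Ico (0 : ℝ) 1)) := by
  classical
  have hs0 : MeasurableSet s := dyadicFiltration.le n s hs
  rw [dyadicAlgebra_eq] at hs
  obtain ⟨T, -, rfl⟩ := hs
  rw [Measure.restrict_restrict hs0]
  have e : ix n ⁻¹' T ∩ Set.Ico (0 : ℝ) 1
      = ⋃ k ∈ (Finset.Ico (0 : ℤ) (2 ^ n)).filter (· ∈ T), ix n ⁻¹' {k} := by
    ext x
    simp only [Set.mem_inter_iff, Set.mem_preimage, Finset.mem_filter, Set.mem_iUnion,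
      Set.mem_singleton_iff, exists_prop, exists_eq_right', Finset.mem_Ico]
    constructor
    · rintro ⟨h1, h2⟩
      exact ⟨ix_mem n h2, h1⟩
    · rintro ⟨h1, h2⟩
      exact ⟨h2, cell_sub n _ h1 rfl⟩
  have hd : Set.Pairwise (↑((Finset.Ico (0 : ℤ) (2 ^ n)).filter (· ∈ T)))
      (Function.onFun Disjoint fun k => ix n ⁻¹' {k}) := by
    intro a _ b _ hab
    exact Disjoint.preimage _ (by simpa using hab)
  have hint : ∀ m, ∀ k ∈ (Finset.Ico (0 : ℤ) (2 ^ n)).filter (· ∈ T),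
      IntegrableOn (val G m) (ix n ⁻¹' {k}) := by
    intro m k hk
    simp only [Finset.mem_filter, Finset.mem_Ico] at hk
    exact IntegrableOn.mono_set (val_integrable G m) (cell_sub n k hk.1)
  rw [e, integral_biUnion_finset _ (fun k _ => ix_measurable' n (measurableSet_singleton k)) hd
    (hint n), integral_biUnion_finset _
    (fun k _ => ix_measurable' n (measurableSet_singleton k)) hd (hint (n + 1))]
  refine Finset.sum_congr rfl fun k hk => ?_
  simp only [Finset.mem_filter, Finset.mem_Ico] at hk
  rw [setIntegral_cell, setIntegral_cell_succ G n k hk.1, ← hG n k, ← two_smul ℝ (G n k),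
    smul_smul]
  congr 1
  rw [pow_succ]
  field_simp

/-- dyadic filtration with trivial beginning -/
noncomputable def filt : Filtration ℕ (Real.measurableSpace) where
  seq := fun n => if n = 0 then ⊥ else dyadicAlgebra n
  mono' := by
    intro a b hab
    dsimp only
    split_ifs with h1 h2
    · exact le_rfl
    · exact bot_le
    · omega
    · exact dyadicFiltration.mono hab
  le' := by
    intro n
    split_ifs
    · exact bot_le
    · exact dyadicFiltration.le n

lemma filt_zero : filt 0 = ⊥ := rfl
lemma filt_succ (n : ℕ) : filt (n + 1) = dyadicAlgebra (n + 1) := rfl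
lemma filt_le (n : ℕ) : filt n ≤ dyadicAlgebra n := by
  cases n with
  | zero => exact bot_le
  | succ n => exact le_rfl

lemma val_martingale [CompleteSpace X] {G : ℕ → ℤ → X} (hG : Avg G) (h0 : ∀ k, G 0 k = G 0 0) :
    Martingale (val G) filt (volume.restrict (Set.Ico (0 : ℝ) 1)) := by
  have had : StronglyAdapted filt (val G) := by
    intro n
    cases n with
    | zero =>
      have : val G 0 = fun _ => G 0 0 := by
        funext x
        exact h0 _
      rw [this]
      exact stronglyMeasurable_const
    | succ n => exact val_sm G (n + 1)
  refine martingale_nat had (val_integrable G) fun n => ?_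
  refine ae_eq_condExp_of_forall_setIntegral_eq (filt.le n) (val_integrable G (n + 1))
    (fun s _ _ => (val_integrable G n).integrableOn) (fun s hs _ => ?_) (had n).aestronglyMeasurable
  exact setIntegral_eq_succ hG n s (filt_le n s hs)

/-- cumulated predictable `p`-variation -/
noncomputable def V (p : ℝ) (G : ℕ → ℤ → X) : ℕ → ℤ → ℝ
  | 0, k => ‖G 1 (2 * k) - G 0 k‖ ^ p
  | n + 1, k => V p G n (k / 2) + ‖G (n + 2) (2 * k) - G (n + 1) k‖ ^ p

/-- stopped tree -/
noncomputable def St (p C : ℝ) (G : ℕ → ℤ → X) : ℕ → ℤ → X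
  | 0, k => G 0 k
  | n + 1, m => St p C G n (m / 2) +
      if V p G n (m / 2) ≤ C then G (n + 1) m - G n (m / 2) else 0

lemma St_avg {p C : ℝ} {G : ℕ → ℤ → X} (hG : Avg G) : Avg (St p C G) := by
  intro n k
  have e1 : (2 * k) / 2 = k := by omega
  have e2 : (2 * k + 1) / 2 = k := by omega
  simp only [St, e1, e2]
  have := hG n k
  split_ifs with h
  · have h2 : G (n + 1) (2 * k + 1) = G n k + G n k - G (n + 1) (2 * k) := by
      rw [this]; abel
    rw [h2]; abel
  · abel

lemma St_diff {p C : ℝ} {G : ℕ → ℤ → X} (n : ℕ) (x : ℝ) :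
    val (St p C G) (n + 1) x - val (St p C G) n x =
      if V p G n (ix n x) ≤ C then val G (n + 1) x - val G n x else 0 := by
  simp only [val, St, ix_succ_div]
  abel

lemma V_val {p : ℝ} {G : ℕ → ℤ → X} (hG : Avg G) (n : ℕ) (x : ℝ) :
    V p G n (ix n x) = ∑ i ∈ Finset.range (n + 1), ‖val G (i + 1) x - val G i x‖ ^ p := by
  induction n with
  | zero => simp only [V, zero_add, Finset.sum_range_one, diff_norm hG 0]
  | succ n ih =>
    rw [Finset.sum_range_succ, ← ih, diff_norm hG (n + 1)]
    simp only [V, ix_succ_div]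

lemma St_sum {p C : ℝ} (hp : 0 < p) (hC : 0 ≤ C) {G : ℕ → ℤ → X} (hG : Avg G) (n : ℕ) (x : ℝ) :
    ∑ i ∈ Finset.range n, ‖val (St p C G) (i + 1) x - val (St p C G) i x‖ ^ p ≤ C := by
  have key : ∀ i, ‖val (St p C G) (i + 1) x - val (St p C G) i x‖ ^ p
      = if V p G i (ix i x) ≤ C then ‖val G (i + 1) x - val G i x‖ ^ p else 0 := by
    intro i
    rw [St_diff]
    split_ifs
    · rfl
    · simp [hp.ne']
  simp only [key]
  induction n with
  | zero => simpa using hC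
  | succ n ih =>
    by_cases h : V p G n (ix n x) ≤ C
    · refine le_trans ?_ h
      rw [V_val hG]
      refine Finset.sum_le_sum fun i _ => ?_
      split_ifs
      · exact le_rfl
      · positivity
    · rw [Finset.sum_range_succ, if_neg h, add_zero]
      exact ih

/-- the maximal function -/
noncomputable def Mx (G : ℕ → ℤ → X) (x : ℝ) : ℝ≥0∞ :=
  ⨆ j : ℕ, (‖val G (j + 1) x - val G 0 x‖₊ : ℝ≥0∞)

/-- the `p`-variation -/
noncomputable def Q (p : ℝ) (G : ℕ → ℤ → X) (x : ℝ) : ℝ≥0∞ :=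
  ∑' j : ℕ, ENNReal.ofReal (‖val G (j + 1) x - val G j x‖ ^ p)

lemma Mx_meas (G : ℕ → ℤ → X) : Measurable (Mx G) := by
  refine Measurable.iSup fun j => ?_
  exact ((val_sm' G (j + 1)).sub (val_sm' G 0)).enorm

lemma Q_meas (p : ℝ) (G : ℕ → ℤ → X) : Measurable (Q p G) := by
  refine Measurable.tsum fun j => ?_
  exact (((val_sm' G (j + 1)).sub (val_sm' G j)).norm.measurable.pow_const p).ennreal_ofReal

lemma St_eq {p C : ℝ} (hC : 0 ≤ C) {G : ℕ → ℤ → X} (hG : Avg G) {x : ℝ}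
    (hx : Q p G x ≤ ENNReal.ofReal C) (n : ℕ) : val (St p C G) n x = val G n x := by
  induction n with
  | zero => rfl
  | succ n ih =>
    have hV : V p G n (ix n x) ≤ C := by
      rw [V_val hG, ← ENNReal.ofReal_le_ofReal_iff hC, ENNReal.ofReal_sum_of_nonneg
        (fun _ _ => by positivity)]
      exact (ENNReal.sum_le_tsum _).trans hx
    have := St_diff (p := p) (C := C) (G := G) n x
    rw [if_pos hV, ih, sub_left_inj] at this
    exact this

lemma azuma_cell [CompleteSpace X] {p K : ℝ} (hp : 0 < p) (hK : 0 < K)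
    (hX : HasAzumaType X p K) {G : ℕ → ℤ → X} (hG : Avg G) (h0 : ∀ k, G 0 k = G 0 0)
    (h1 : ∀ k, G 1 (2 * k) = G 1 0) {t C : ℝ} (ht : 0 < t) (hC : 0 < C) :
    volume ({x | ENNReal.ofReal t ≤ Mx G x ∧ Q p G x ≤ ENNReal.ofReal C} ∩ Set.Ico (0 : ℝ) 1)
      ≤ ENNReal.ofReal (2 * Real.exp (-(t ^ p) / (K * C))) := by
  set H := St p C G with hH
  have hHA : Avg H := St_avg hG
  have hH0 : ∀ k, H 0 k = H 0 0 := h0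
  have hH1 : ∀ k, H 1 (2 * k) = H 1 0 := by
    intro k
    have e1 : (2 * k) / 2 = k := by omega
    simp only [hH, St, V, e1, h1, h0 k]
    simp
  set μ : Measure ℝ := volume.restrict (Set.Ico (0 : ℝ) 1) with hμ
  have hprob : IsProbabilityMeasure μ := ⟨by simp [hμ]⟩
  let w : ℕ → ℝ → ℝ := fun n x => ‖val H n x - val H (n - 1) x‖
  have hwdef : ∀ j x, w (j + 1) x = ‖val H (j + 1) x - val H j x‖ := fun j x => rfl
  have hwm : ∀ j : ℕ, StronglyMeasurable[filt j] (w (j + 1)) := by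
    intro j
    have e : w (j + 1) = fun x => ‖H (j + 1) (2 * ix j x) - H j (ix j x)‖ := by
      funext x
      rw [hwdef, diff_norm hHA]
    rw [e]
    cases j with
    | zero =>
      simp only [zero_add, hH1, hH0 (ix _ _)]
      exact stronglyMeasurable_const
    | succ j =>
      have h : StronglyMeasurable
        (fun k : ℤ => ‖H (j + 1 + 1) (2 * k) - H (j + 1) k‖) := StronglyMeasurable.of_discrete
      exact h.comp_measurable (ix_measurable (j + 1))
  have main := hX ℝ Real.measurableSpace μ hprob filt filt_zero (val H) (val_martingale hHA hH0) w
    (fun j x => norm_nonneg _) hwm (fun j => ae_of_all _ fun x => le_rfl) t ht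
  set E := essSup (fun ω => ∑' j : ℕ, ENNReal.ofReal (w (j + 1) ω ^ p)) μ with hE
  have hEC : E ≤ ENNReal.ofReal C := by
    refine essSup_le_of_ae_le _ (ae_of_all _ fun x => ?_)
    refine ENNReal.tsum_le_of_sum_range_le fun n => ?_
    rw [← ENNReal.ofReal_sum_of_nonneg (fun i _ => Real.rpow_nonneg (norm_nonneg _) _)]
    exact ENNReal.ofReal_le_ofReal (St_sum hp hC.le hG n x)
  have hsub : volume ({x | ENNReal.ofReal t ≤ Mx G x ∧ Q p G x ≤ ENNReal.ofReal C}
      ∩ Set.Ico (0 : ℝ) 1) ≤ μ {x | ENNReal.ofReal t ≤ Mx H x} := by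
    rw [hμ, Measure.restrict_apply' measurableSet_Ico]
    refine measure_mono (Set.inter_subset_inter_left _ ?_)
    rintro x ⟨hx1, hx2⟩
    have : Mx H x = Mx G x := by
      simp only [Mx, hH, St_eq hC.le hG hx2]
    simpa [this] using hx1
  refine hsub.trans ?_
  by_cases hE0 : E = 0
  · have h := ENNReal.essSup_eq_zero_iff.1 hE0
    have : μ {x | ENNReal.ofReal t ≤ Mx H x} = 0 := by
      rw [← nonpos_iff_eq_zero, ← ae_iff.1 (h.mono fun x hx => ?_ :
        ∀ᵐ x ∂μ, ¬ ENNReal.ofReal t ≤ Mx H x)]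
      · simp
      · simp only [Pi.zero_apply, ENNReal.tsum_eq_zero] at hx
        have hz : ∀ j, val H (j + 1) x = val H j x := by
          intro j
          have := hx j
          rw [ENNReal.ofReal_eq_zero] at this
          have h3 : w (j + 1) x ^ p = 0 := le_antisymm this (Real.rpow_nonneg (norm_nonneg _) _)
          rw [Real.rpow_eq_zero (norm_nonneg _) hp.ne', norm_eq_zero, sub_eq_zero] at h3
          exact h3
        have hz' : ∀ j, val H j x = val H 0 x := by
          intro j
          induction j with
          | zero => rfl
          | succ j ih => rw [hz, ih]
        simp [Mx, hz', ht]
    rw [this]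
    exact zero_le
  · refine main.trans (ENNReal.ofReal_le_ofReal ?_)
    have hEt : E ≠ ∞ := ne_top_of_le_ne_top ENNReal.ofReal_ne_top hEC
    have hpos : 0 < E.toReal := ENNReal.toReal_pos hE0 hEt
    have hle : E.toReal ≤ C := ENNReal.toReal_le_of_le_ofReal hC.le hEC
    have htp : 0 < t ^ p := by positivity
    rw [neg_div, neg_div]
    gcongr

/-- a single coin toss -/
noncomputable def coin (v : X) : ℕ → ℤ → X
  | 0, _ => 0
  | 1, m => if m % 2 = 0 then v else -v
  | n + 2, m => coin v (n + 1) (m / 2)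

lemma const_bound [CompleteSpace X] [Nontrivial X] {p K : ℝ} (hp : 0 < p) (hK : 0 < K)
    (hX : HasAzumaType X p K) : 1 ≤ K * Real.log 2 := by
  obtain ⟨v, hv⟩ := exists_ne (0 : X)
  have hv' : 0 < ‖v‖ := norm_pos_iff.2 hv
  have hA : Avg (coin v) := by
    intro n k
    cases n with
    | zero =>
      have e1 : (2 * k) % 2 = 0 := by omega
      have e2 : (2 * k + 1) % 2 = 1 := by omega
      simp [coin, e1, e2]
    | succ n =>
      have e1 : (2 * k) / 2 = k := by omega
      have e2 : (2 * k + 1) / 2 = k := by omega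
      simp [coin, e1, e2]
  have h := azuma_cell hp hK hX hA (fun _ => rfl) (fun k => by simp [coin]) hv'
    (C := ‖v‖ ^ p) (by positivity)
  have hn : ∀ x, ‖val (coin v) 1 x - val (coin v) 0 x‖ = ‖v‖ := by
    intro x
    simp only [val, coin, sub_zero]
    split_ifs <;> simp
  have hs : {x | ENNReal.ofReal ‖v‖ ≤ Mx (coin v) x ∧ Q p (coin v) x ≤ ENNReal.ofReal (‖v‖ ^ p)}
      = Set.univ := by
    refine Set.eq_univ_of_forall fun x => ⟨?_, ?_⟩
    · refine le_trans ?_ (le_iSup _ 0)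
      rw [← hn x]
      exact (ofReal_norm _).le
    · unfold Q
      rw [tsum_eq_single 0]
      · rw [zero_add, hn]
      · intro j hj
        obtain ⟨j, rfl⟩ := Nat.exists_eq_succ_of_ne_zero hj
        have : val (coin v) (j + 1 + 1) x = val (coin v) (j + 1) x := by
          simp only [val, coin, ix_succ_div]
        rw [Nat.succ_eq_add_one, this]
        simp [hp.ne']
  rw [hs, Set.univ_inter, Real.volume_Ico, sub_zero, ENNReal.ofReal_le_ofReal_iff (by positivity)]
    at h
  have hvp : 0 < ‖v‖ ^ p := by positivity
  have e : -(‖v‖ ^ p) / (K * ‖v‖ ^ p) = -(1 / K) := by field_simp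
  rw [e, Real.exp_neg] at h
  have h2 : Real.exp (1 / K) ≤ 2 := by
    have := Real.exp_pos (1 / K)
    rw [← div_eq_mul_inv, le_div_iff₀ this] at h
    linarith
  have h3 : 1 / K ≤ Real.log 2 := by
    rw [Real.le_log_iff_exp_le (by norm_num)]; exact h2
  rw [div_le_iff₀ hK] at h3
  linarith

lemma emod_even (m : ℕ) (b : ℤ) : (2 * b) % 2 ^ (m + 1) = 2 * (b % 2 ^ m) := by
  rw [pow_succ', Int.mul_emod_mul_of_pos _ _ (by norm_num)]

lemma emod_odd (m : ℕ) (b : ℤ) : (2 * b + 1) % 2 ^ (m + 1) = 2 * (b % 2 ^ m) + 1 := by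
  have hpos : (0 : ℤ) < 2 ^ m := by positivity
  have h1 := Int.emod_nonneg b hpos.ne'
  have h2 := Int.emod_lt_of_pos b hpos
  have h3 := Int.mul_ediv_add_emod b (2 ^ m)
  have h4 : 2 * b + 1 = (2 * (b % 2 ^ m) + 1) + 2 ^ (m + 1) * (b / 2 ^ m) := by
    rw [pow_succ]; linarith
  rw [h4, Int.add_mul_emod_self_left]
  apply Int.emod_eq_of_lt
  · omega
  · rw [pow_succ]; omega

/-- subtree below a node, made periodic -/
def sub (G : ℕ → ℤ → X) (n : ℕ) (a : ℤ) (m : ℕ) (b : ℤ) : X :=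
  G (n + m) (2 ^ m * a + b % 2 ^ m)

lemma sub_avg {G : ℕ → ℤ → X} (hG : Avg G) (n : ℕ) (a : ℤ) : Avg (sub G n a) := by
  intro m b
  unfold sub
  rw [emod_even, emod_odd, hG, pow_succ']
  congr 2 <;> ring

lemma sub_zero' (G : ℕ → ℤ → X) (n : ℕ) (a k : ℤ) : sub G n a 0 k = sub G n a 0 0 := by
  simp [sub, Int.emod_one]

lemma sub_one' (G : ℕ → ℤ → X) (n : ℕ) (a k : ℤ) : sub G n a 1 (2 * k) = sub G n a 1 0 := by
  simp [sub]

lemma val_sub (G : ℕ → ℤ → X) (n m : ℕ) (a : ℤ) (x : ℝ) (hx : ix n x = a) :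
    val (sub G n a) m (2 ^ n * x - a) = val G (n + m) x := by
  have hy : (2 : ℝ) ^ n * x - a ∈ Set.Ico (0 : ℝ) 1 := by
    unfold ix at hx
    rw [Int.floor_eq_iff] at hx
    constructor <;> linarith [hx.1, hx.2]
  have h1 := ix_mem m hy
  unfold val sub
  rw [Int.emod_eq_of_lt h1.1 h1.2]
  congr 1
  unfold ix
  have : (2 : ℝ) ^ (n + m) * x = ((2 ^ m * a : ℤ) : ℝ) + 2 ^ m * (2 ^ n * x - a) := by
    push_cast; ring
  rw [this, Int.floor_intCast_add]

lemma azuma_sub [CompleteSpace X] {p K : ℝ} (hp : 0 < p) (hK : 0 < K)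
    (hX : HasAzumaType X p K) {G : ℕ → ℤ → X} (hG : Avg G) (n : ℕ) (a : ℤ)
    {t C : ℝ} (ht : 0 < t) (hC : 0 < C) :
    volume {x | ix n x = a ∧
        ENNReal.ofReal t ≤ (⨆ j : ℕ, (‖val G (n + (j + 1)) x - val G n x‖₊ : ℝ≥0∞)) ∧
        Q p G x ≤ ENNReal.ofReal C}
      ≤ ENNReal.ofReal (2 * Real.exp (-(t ^ p) / (K * C))) * volume (ix n ⁻¹' {a}) := by
  have h := azuma_cell hp hK hX (sub_avg hG n a) (sub_zero' G n a) (sub_one' G n a) ht hC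
  set T := {x | ENNReal.ofReal t ≤ Mx (sub G n a) x ∧ Q p (sub G n a) x ≤ ENNReal.ofReal C} ∩
    Set.Ico (0 : ℝ) 1 with hT
  have h2 : (2 : ℝ) ^ n ≠ 0 := by positivity
  have hc : volume (ix n ⁻¹' {a}) = ENNReal.ofReal (abs ((2 : ℝ) ^ n)⁻¹) := by
    rw [ix_preimage, Real.volume_Ico, abs_of_pos (by positivity)]
    congr 1
    field_simp
    ring
  have hv : volume (((2 : ℝ) ^ n * ·) ⁻¹' ((fun y => y - (a : ℝ)) ⁻¹' T))
      = ENNReal.ofReal (abs ((2 : ℝ) ^ n)⁻¹) * volume T := by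
    simp only [sub_eq_add_neg]
    rw [Real.volume_preimage_mul_left h2, measure_preimage_add_right]
  rw [hc, mul_comm]
  refine le_trans ?_ (mul_le_mul_right h _)
  rw [← hv]
  refine measure_mono ?_
  rintro x ⟨hx, hx1, hx2⟩
  have hval := fun m => val_sub G n m a x hx
  show (2 : ℝ) ^ n * x - a ∈ T
  refine ⟨⟨?_, ?_⟩, ?_⟩
  · simp only [Mx, hval]
    exact hx1
  · refine le_trans ?_ hx2
    simp only [Q, hval]
    exact ENNReal.tsum_comp_le_tsum_of_injective (f := fun j => n + j)
      (add_right_injective n) (fun j => ENNReal.ofReal (‖val G (j + 1) x - val G j x‖ ^ p))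
  · unfold ix at hx
    rw [Int.floor_eq_iff] at hx
    constructor <;> linarith [hx.1, hx.2]

lemma ix_eq_of_le {m n : ℕ} (h : m ≤ n) {x y : ℝ} (hxy : ix n x = ix n y) : ix m x = ix m y := by
  induction n, h using Nat.le_induction with
  | base => exact hxy
  | succ n _ ih =>
    apply ih
    rw [← ix_succ_div, hxy, ix_succ_div]

lemma good_lambda [CompleteSpace X] {p K : ℝ} (hp : 0 < p) (hK : 0 < K)
    (hX : HasAzumaType X p K) {G : ℕ → ℤ → X} (hG : Avg G) {δ l : ℝ} (hδ : 0 < δ) (hδ1 : δ < 1)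
    (hl : 0 < l) :
    volume ({x | ENNReal.ofReal (2 * l) < Mx G x ∧ Q p G x ≤ ENNReal.ofReal ((δ * l) ^ p)} ∩
        Set.Ico (0 : ℝ) 1)
      ≤ ENNReal.ofReal (2 * Real.exp (-(((1 - δ) * l) ^ p) / (K * (δ * l) ^ p))) *
        volume ({x | ENNReal.ofReal l < Mx G x} ∩ Set.Ico (0 : ℝ) 1) := by
  classical
  set B := {x | ENNReal.ofReal (2 * l) < Mx G x ∧ Q p G x ≤ ENNReal.ofReal ((δ * l) ^ p)} ∩
        Set.Ico (0 : ℝ) 1 with hB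
  set ε := ENNReal.ofReal (2 * Real.exp (-(((1 - δ) * l) ^ p) / (K * (δ * l) ^ p))) with hε
  let N : ℕ → ℝ → ℝ := fun j x => ‖val G (j + 1) x - val G 0 x‖
  have hNdef : ∀ j x, N j x = ‖val G (j + 1) x - val G 0 x‖ := fun j x => rfl
  have hmx : ∀ c : ℝ, 0 ≤ c → ∀ x, ENNReal.ofReal c < Mx G x ↔ ∃ j, c < N j x := by
    intro c hc x
    simp only [Mx, lt_iSup_iff]
    refine exists_congr fun j => ?_
    have : ((‖val G (j + 1) x - val G 0 x‖₊ : ℝ≥0∞)) = ENNReal.ofReal (N j x) :=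
      (ofReal_norm _).symm
    rw [this, ENNReal.ofReal_lt_ofReal_iff_of_nonneg hc]
  let E : ℕ × ℤ → Set ℝ := fun q =>
    {x | x ∈ Set.Ico (0 : ℝ) 1 ∧ ix (q.1 + 1) x = q.2 ∧ l < N q.1 x ∧ ∀ j < q.1, N j x ≤ l}
  have hcell : ∀ q, (E q).Nonempty → E q = ix (q.1 + 1) ⁻¹' {q.2} := by
    rintro q ⟨x, hx, hxi, hx1, hx2⟩
    apply Set.Subset.antisymm
    · rintro y ⟨-, hy, -⟩
      exact hy
    · intro y hy
      have hy' : ix (q.1 + 1) y = ix (q.1 + 1) x := by rw [hxi]; exact hy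
      have hv : ∀ j ≤ q.1, N j y = N j x := by
        intro j hj
        rw [hNdef, hNdef]
        unfold val
        rw [ix_eq_of_le (by omega) hy', ix_eq_of_le (Nat.zero_le _) hy']
      refine ⟨cell_sub _ _ (hxi ▸ ix_mem (q.1 + 1) hx) hy, hy, ?_, ?_⟩
      · rw [hv _ le_rfl]; exact hx1
      · intro j hj
        rw [hv j hj.le]; exact hx2 j hj
  have hEm : ∀ q, MeasurableSet (E q) := by
    intro q
    rcases (E q).eq_empty_or_nonempty with h | h
    · rw [h]; exact MeasurableSet.empty
    · rw [hcell q h]; exact ix_measurable' _ (measurableSet_singleton _)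
  have hEd : Pairwise (Function.onFun Disjoint E) := by
    rintro ⟨n, a⟩ ⟨n', a'⟩ hne
    refine Set.disjoint_left.2 ?_
    rintro x ⟨-, h1, h2, h3⟩ ⟨-, h1', h2', h3'⟩
    apply hne
    dsimp only at h1 h2 h3 h1' h2' h3'
    have : n = n' := by
      rcases lt_trichotomy n n' with h | h | h
      · exact absurd (h3' n h) (not_le.2 h2)
      · exact h
      · exact absurd (h3 n' h) (not_le.2 h2')
    subst this
    rw [← h1, ← h1']
  have hcover : ∀ x, x ∈ Set.Ico (0 : ℝ) 1 → ENNReal.ofReal l < Mx G x → ∃ q, x ∈ E q := by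
    intro x hx hl'
    have hex := (hmx l hl.le x).1 hl'
    exact ⟨(Nat.find hex, ix (Nat.find hex + 1) x), hx, rfl, Nat.find_spec hex,
      fun j hj => not_lt.1 (Nat.find_min hex hj)⟩
  have hBE : ∀ q, volume (B ∩ E q) ≤ ε * volume (E q) := by
    intro q
    rcases (E q).eq_empty_or_nonempty with h | h
    · simp [h]
    · rw [hcell q h]
      refine le_trans (measure_mono ?_) (azuma_sub hp hK hX hG (q.1 + 1) q.2
        (t := (1 - δ) * l) (C := (δ * l) ^ p) (by nlinarith) (by positivity))
      rintro x ⟨⟨⟨hx1, hx2⟩, hx3⟩, hx4⟩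
      refine ⟨hx4, ?_, hx2⟩
      rw [← hcell q h] at hx4
      obtain ⟨-, -, h5, h6⟩ := hx4
      have hd : ‖val G (q.1 + 1) x - val G q.1 x‖ ≤ δ * l := by
        have hh := (ENNReal.le_tsum q.1).trans hx2
        rw [ENNReal.ofReal_le_ofReal_iff (by positivity)] at hh
        exact (Real.rpow_le_rpow_iff (norm_nonneg _) (by positivity) hp).1 hh
      have hq : ‖val G q.1 x - val G 0 x‖ ≤ l := by
        rcases Nat.eq_zero_or_pos q.1 with h0 | h0
        · rw [h0]; simpa using hl.le
        · have := h6 (q.1 - 1) (by omega)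
          rw [hNdef, Nat.sub_add_cancel h0] at this
          exact this
      have hn : N q.1 x ≤ l + δ * l := by
        have := norm_add_le (val G q.1 x - val G 0 x) (val G (q.1 + 1) x - val G q.1 x)
        rw [show val G q.1 x - val G 0 x + (val G (q.1 + 1) x - val G q.1 x)
          = val G (q.1 + 1) x - val G 0 x by abel] at this
        rw [hNdef]
        linarith
      obtain ⟨m, hm⟩ := (hmx (2 * l) (by positivity) x).1 hx1
      have hmq : q.1 < m := by
        by_contra hcon
        rcases (not_lt.1 hcon).lt_or_eq with h7 | h7
        · have := h6 m h7; linarith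
        · rw [h7] at hm; nlinarith
      obtain ⟨j, rfl⟩ : ∃ j, m = q.1 + 1 + j := ⟨m - (q.1 + 1), by omega⟩
      refine le_trans ?_ (le_iSup _ j)
      have hfin : (1 - δ) * l ≤ ‖val G (q.1 + 1 + (j + 1)) x - val G (q.1 + 1) x‖ := by
        have := norm_add_le (val G (q.1 + 1 + (j + 1)) x - val G (q.1 + 1) x)
          (val G (q.1 + 1) x - val G 0 x)
        rw [sub_add_sub_cancel] at this
        rw [hNdef] at hm hn
        rw [show q.1 + 1 + j + 1 = q.1 + 1 + (j + 1) by ring] at hm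
        linarith
      refine (ENNReal.ofReal_le_ofReal hfin).trans (ofReal_norm _).le
  calc volume B ≤ volume (⋃ q, B ∩ E q) := by
        refine measure_mono ?_
        rintro x hx
        obtain ⟨q, hq⟩ := hcover x hx.2
          (lt_of_le_of_lt (ENNReal.ofReal_le_ofReal (by linarith)) hx.1.1)
        exact Set.mem_iUnion.2 ⟨q, hx, hq⟩
    _ ≤ ∑' q, volume (B ∩ E q) := measure_iUnion_le _
    _ ≤ ∑' q, ε * volume (E q) := ENNReal.tsum_le_tsum hBE
    _ = ε * volume (⋃ q, E q) := by rw [ENNReal.tsum_mul_left, measure_iUnion hEd hEm]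
    _ ≤ _ := by
        refine mul_le_mul_right (measure_mono ?_) _
        refine Set.iUnion_subset fun q => ?_
        rintro x ⟨h1, h2, h3, h4⟩
        exact ⟨(hmx l hl.le x).2 ⟨_, h3⟩, h1⟩

lemma integrate_good {α : Type*} [MeasurableSpace α] (μ : Measure α) [IsFiniteMeasure μ]
    {u s : α → ℝ} (hu : Measurable u) (hs : Measurable s) (hu0 : ∀ x, 0 ≤ u x)
    (hs0 : ∀ x, 0 ≤ s x) {N : ℝ} (huN : ∀ x, u x ≤ N) {ε δ r : ℝ} (hr : 0 < r) (hδ : 0 < δ)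
    (hεr : 2 ^ r * ε = 1 / 2)
    (h : ∀ t, 0 < t → μ {x | 2 * t < u x} ≤
      ENNReal.ofReal ε * μ {x | t < u x} + μ {x | δ * t < s x}) :
    ∫⁻ x, ENNReal.ofReal (u x ^ r) ∂μ ≤
      ENNReal.ofReal (2 ^ (r + 1) * (1 / δ) ^ r) * ∫⁻ x, ENNReal.ofReal (s x ^ r) ∂μ := by
  set Iu := ∫⁻ x, ENNReal.ofReal (u x ^ r) ∂μ with hIu
  set Is := ∫⁻ x, ENNReal.ofReal (s x ^ r) ∂μ with hIs
  have hfin : Iu ≠ ∞ := by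
    have : Iu ≤ ∫⁻ _, ENNReal.ofReal (N ^ r) ∂μ :=
      lintegral_mono fun x => ENNReal.ofReal_le_ofReal
        (Real.rpow_le_rpow (hu0 x) (huN x) hr.le)
    refine ne_top_of_le_ne_top ?_ this
    rw [lintegral_const]
    exact ENNReal.mul_ne_top ENNReal.ofReal_ne_top (measure_ne_top _ _)
  have scale : ∀ (c : ℝ) (v : α → ℝ), 0 ≤ c → (∀ x, 0 ≤ v x) →
      ∫⁻ x, ENNReal.ofReal ((c * v x) ^ r) ∂μ
        = ENNReal.ofReal (c ^ r) * ∫⁻ x, ENNReal.ofReal (v x ^ r) ∂μ := by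
    intro c v hc hv
    rw [← lintegral_const_mul' _ _ ENNReal.ofReal_ne_top]
    refine lintegral_congr fun x => ?_
    rw [Real.mul_rpow hc (hv x), ENNReal.ofReal_mul (by positivity)]
  have l1 := lintegral_rpow_eq_lintegral_meas_lt_mul μ (f := fun x => (1 / 2) * u x)
    (ae_of_all _ fun x => by have := hu0 x; simp only [Pi.zero_apply]; positivity)
    (hu.const_mul _).aemeasurable hr
  have l2 := lintegral_rpow_eq_lintegral_meas_lt_mul μ (f := u)
    (ae_of_all _ hu0) hu.aemeasurable hr
  have l3 := lintegral_rpow_eq_lintegral_meas_lt_mul μ (f := fun x => (1 / δ) * s x)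
    (ae_of_all _ fun x => by have := hs0 x; simp only [Pi.zero_apply]; positivity)
    (hs.const_mul _).aemeasurable hr
  rw [scale _ _ (by positivity) hu0] at l1
  rw [scale _ _ (by positivity) hs0] at l3
  have key : ENNReal.ofReal ((1 / 2) ^ r) * Iu
      ≤ ENNReal.ofReal ε * Iu + ENNReal.ofReal ((1 / δ) ^ r) * Is := by
    rw [l1, l3, hIu, l2, mul_left_comm, ← mul_add]
    refine mul_le_mul_right ?_ _
    rw [← lintegral_const_mul' _ _ ENNReal.ofReal_ne_top, ← lintegral_add_left]
    · refine setLIntegral_mono' measurableSet_Ioi fun t ht => ?_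
      rw [← mul_assoc, ← add_mul]
      refine mul_le_mul_left ?_ _
      have e1 : {x | t < 1 / 2 * u x} = {x | 2 * t < u x} := by
        ext x; simp only [Set.mem_setOf_eq]; constructor <;> intro h <;> linarith
      have e2 : {x | t < 1 / δ * s x} = {x | δ * t < s x} := by
        ext x; simp only [Set.mem_setOf_eq]
        rw [one_div, inv_mul_eq_div, lt_div_iff₀ hδ, mul_comm]
      rw [e1, e2]
      exact h t ht
    · have hanti : Antitone fun t : ℝ => μ {x | t < u x} := by
        intro a b hab
        exact measure_mono fun x (hx : b < u x) => lt_of_le_of_lt hab hx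
      exact (hanti.measurable.mul
        ((measurable_id.pow_const (r - 1)).ennreal_ofReal)).const_mul _
  have h2r : (0 : ℝ) < 2 ^ r := by positivity
  have key2 : Iu ≤ ENNReal.ofReal (1 / 2) * Iu + ENNReal.ofReal (2 ^ r * (1 / δ) ^ r) * Is := by
    have := mul_le_mul_right key (ENNReal.ofReal (2 ^ r))
    rw [mul_add, ← mul_assoc, ← mul_assoc, ← mul_assoc, ← ENNReal.ofReal_mul h2r.le,
      ← ENNReal.ofReal_mul h2r.le, ← ENNReal.ofReal_mul h2r.le, hεr,
      ← Real.mul_rpow (by norm_num) (by norm_num)] at this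
    norm_num at this
    simpa using this
  have hhalf : ENNReal.ofReal (1 / 2) * Iu + ENNReal.ofReal (1 / 2) * Iu = Iu := by
    rw [← add_mul, ← ENNReal.ofReal_add (by norm_num) (by norm_num)]
    norm_num
  have hhf : ENNReal.ofReal (1 / 2) * Iu ≠ ∞ := ENNReal.mul_ne_top ENNReal.ofReal_ne_top hfin
  have key3 : ENNReal.ofReal (1 / 2) * Iu ≤ ENNReal.ofReal (2 ^ r * (1 / δ) ^ r) * Is := by
    rw [← ENNReal.add_le_add_iff_left hhf, hhalf]
    exact key2
  rw [← hhalf]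
  refine (add_le_add key3 key3).trans (le_of_eq ?_)
  rw [← add_mul, ← ENNReal.ofReal_add (by positivity) (by positivity), Real.rpow_add (by norm_num)]
  congr 2
  rw [Real.rpow_one]; ring

lemma integrate_good' {α : Type*} [MeasurableSpace α] (μ : Measure α) [IsFiniteMeasure μ]
    {F S : α → ℝ≥0∞} (hF : Measurable F) (hS : Measurable S) {ε δ r : ℝ} (hr : 0 < r) (hδ : 0 < δ)
    (hεr : 2 ^ r * ε = 1 / 2)
    (h : ∀ t, 0 < t → μ {x | ENNReal.ofReal (2 * t) < F x ∧ S x ≤ ENNReal.ofReal (δ * t)} ≤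
      ENNReal.ofReal ε * μ {x | ENNReal.ofReal t < F x}) :
    ∫⁻ x, F x ^ r ∂μ ≤
      ENNReal.ofReal (2 ^ (r + 1) * (1 / δ) ^ r) * ∫⁻ x, S x ^ r ∂μ := by
  have step : ∀ N : ℕ, ∫⁻ x, (min (F x) N) ^ r ∂μ ≤
      ENNReal.ofReal (2 ^ (r + 1) * (1 / δ) ^ r) * ∫⁻ x, S x ^ r ∂μ := by
    intro N
    set M : ℝ≥0∞ := ENNReal.ofReal (δ * N) with hM
    have hfF : ∀ x, min (F x) N ≠ ∞ := fun x =>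
      ne_top_of_le_ne_top (ENNReal.natCast_ne_top N) (min_le_right _ _)
    have hfS : ∀ x, min (S x) M ≠ ∞ := fun x =>
      ne_top_of_le_ne_top ENNReal.ofReal_ne_top (min_le_right _ _)
    have main := integrate_good μ (u := fun x => (min (F x) N).toReal)
      (s := fun x => (min (S x) M).toReal) (hF.min measurable_const).ennreal_toReal
      (hS.min measurable_const).ennreal_toReal (fun _ => ENNReal.toReal_nonneg)
      (fun _ => ENNReal.toReal_nonneg) (N := N)
      (fun x => ENNReal.toReal_le_of_le_ofReal (by positivity) (by simp)) hr hδ hεr ?_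
    · simp only [← ENNReal.ofReal_rpow_of_nonneg ENNReal.toReal_nonneg hr.le,
        ENNReal.ofReal_toReal (hfF _), ENNReal.ofReal_toReal (hfS _)] at main
      refine main.trans ?_
      gcongr
      exact min_le_left _ _
    · intro t ht
      have e : ∀ c : ℝ, 0 ≤ c → ∀ x, c < (min (F x) N).toReal ↔
          (ENNReal.ofReal c < F x ∧ c < N) := by
        intro c hc x
        rw [← ENNReal.ofReal_lt_iff_lt_toReal hc (hfF x), lt_min_iff]
        have : ((N : ℝ≥0∞)) = ENNReal.ofReal (N : ℝ) := by simp
        rw [this, ENNReal.ofReal_lt_ofReal_iff_of_nonneg hc]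
      simp only [e _ (by positivity : 0 ≤ 2 * t), e _ ht.le]
      by_cases hN : 2 * t < N
      · have hN' : t < N := by linarith
        simp only [hN, hN', and_true]
        refine le_trans ?_ (add_le_add_left (h t ht) _)
        refine le_trans (measure_mono ?_) (measure_union_le _ _)
        intro x hx
        by_cases hxs : S x ≤ ENNReal.ofReal (δ * t)
        · exact Or.inl ⟨hx, hxs⟩
        · right
          show δ * t < (min (S x) M).toReal
          rw [← ENNReal.ofReal_lt_iff_lt_toReal (by positivity) (hfS x), lt_min_iff]
          refine ⟨not_le.1 hxs, ?_⟩
          rw [hM, ENNReal.ofReal_lt_ofReal_iff_of_nonneg (by positivity)]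
          gcongr
      · simp [hN]
  have hsup : ∀ x, F x ^ r = ⨆ N : ℕ, (min (F x) (N : ℝ≥0∞)) ^ r := by
    intro x
    apply le_antisymm
    · have hlim : Filter.Tendsto (fun N : ℕ => (min (F x) (N : ℝ≥0∞)) ^ r) Filter.atTop
          (nhds (F x ^ r)) := by
        have h1 : Filter.Tendsto (fun N : ℕ => min (F x) (N : ℝ≥0∞)) Filter.atTop
            (nhds (min (F x) ∞)) := tendsto_const_nhds.min ENNReal.tendsto_nat_nhds_top
        rw [min_eq_left le_top] at h1
        exact (ENNReal.continuous_rpow_const.tendsto _).comp h1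
      exact le_of_tendsto' hlim fun N => le_iSup (fun N : ℕ => (min (F x) (N : ℝ≥0∞)) ^ r) N
    · exact iSup_le fun N => ENNReal.rpow_le_rpow (min_le_left _ _) hr.le
  simp only [hsup]
  rw [lintegral_iSup]
  · exact iSup_le step
  · intro N
    exact (hF.min measurable_const).pow_const r
  · intro a b hab x
    refine ENNReal.rpow_le_rpow (min_le_min_left _ ?_) hr.le
    exact_mod_cast hab

lemma tree_moment [CompleteSpace X] {p K : ℝ} (hp : 0 < p) (hK : 0 < K)
    (hX : HasAzumaType X p K) {G : ℕ → ℤ → X} (hG : Avg G) {r : ℝ} (hr : 1 ≤ r) :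
    ∫⁻ x, Mx G x ^ r ∂(volume.restrict (Set.Ico (0 : ℝ) 1))
      ≤ ENNReal.ofReal (4 ^ (r + 1) * ((r + 2) * Real.log 2 * K) ^ (r / p)) *
        ∫⁻ x, Q p G x ^ (r / p) ∂(volume.restrict (Set.Ico (0 : ℝ) 1)) := by
  rcases subsingleton_or_nontrivial X with hs | hn
  · have : ∀ x, Mx G x = 0 := by
      intro x
      simp [Mx, Subsingleton.elim (val G _ x) 0]
    simp only [this]
    rw [ENNReal.zero_rpow_of_pos (by linarith)]
    simp
  have hc := const_bound hp hK hX
  have hlog : 0 < Real.log 2 := Real.log_pos (by norm_num)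
  set A0 := (r + 2) * Real.log 2 * K with hA0
  have hA0' : 1 ≤ A0 := by
    rw [hA0, mul_assoc]; nlinarith
  set A := A0 ^ (1 / p) with hA
  have hA1 : 1 ≤ A := Real.one_le_rpow hA0' (by positivity)
  have hAp : A ^ p = A0 := by
    rw [hA, ← Real.rpow_mul (by linarith), one_div_mul_cancel hp.ne', Real.rpow_one]
  set δ := 1 / (1 + A) with hδ
  have hδ0 : 0 < δ := by positivity
  have hδ1 : δ < 1 := by rw [hδ, div_lt_one (by positivity)]; linarith
  have hratio : 1 - δ = A * δ := by rw [hδ]; field_simp; ring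
  set ε : ℝ := 2 * Real.exp (-(A0 / K)) with hε
  have hεr : 2 ^ r * ε = 1 / 2 := by
    have : A0 / K = Real.log 2 * (r + 2) := by rw [hA0]; field_simp
    rw [hε, this, Real.exp_neg, ← Real.rpow_def_of_pos (by norm_num), Real.rpow_add (by norm_num)]
    have h2r : (0 : ℝ) < 2 ^ r := by positivity
    norm_num
    field_simp
    norm_num
  have main := integrate_good' (volume.restrict (Set.Ico (0 : ℝ) 1)) (Mx_meas G)
    (S := fun x => Q p G x ^ (1 / p)) ((Q_meas p G).pow_const _) (r := r) (by linarith) hδ0 hεr ?_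
  · have e : ∀ x, (Q p G x ^ (1 / p)) ^ r = Q p G x ^ (r / p) := by
      intro x
      rw [← ENNReal.rpow_mul]
      congr 1
      field_simp
    simp only [e] at main
    refine main.trans (mul_le_mul_left (ENNReal.ofReal_le_ofReal ?_) _)
    have e2 : A0 ^ (r / p) = A ^ r := by
      rw [hA, ← Real.rpow_mul (by linarith)]
      congr 1
      field_simp
    rw [e2, hδ, one_div_one_div]
    have h4 : (4 : ℝ) ^ (r + 1) = 2 ^ (r + 1) * (2 ^ r * 2) := by
      rw [show (4 : ℝ) = 2 * 2 by norm_num, Real.mul_rpow (by norm_num) (by norm_num)]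
      congr 1
      rw [Real.rpow_add (by norm_num), Real.rpow_one]
    have h5 : (1 + A) ^ r ≤ 2 ^ r * A ^ r := by
      rw [← Real.mul_rpow (by norm_num) (by linarith)]
      exact Real.rpow_le_rpow (by linarith) (by linarith) (by linarith)
    have h6 : 0 ≤ 2 ^ r * A ^ r := by positivity
    rw [h4, mul_assoc]
    gcongr
    nlinarith
  · intro t ht
    rw [Measure.restrict_apply' measurableSet_Ico, Measure.restrict_apply' measurableSet_Ico]
    have := good_lambda hp hK hX hG hδ0 hδ1 ht
    have e : -((1 - δ) * t) ^ p / (K * (δ * t) ^ p) = -(A0 / K) := by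
      rw [hratio, mul_assoc, Real.mul_rpow (by linarith) (by positivity), hAp]
      have : 0 < (δ * t) ^ p := by positivity
      field_simp
    rw [e] at this
    convert this using 6
    rw [one_div, ENNReal.rpow_inv_le_iff hp, ENNReal.ofReal_rpow_of_nonneg (by positivity) hp.le]

lemma const_on_cell {n : ℕ} {g : ℝ → X} (hg : StronglyMeasurable[dyadicAlgebra n] g) {x y : ℝ}
    (h : ix n x = ix n y) : g x = g y := by
  borelize X
  have hm : MeasurableSet[dyadicAlgebra n] (g ⁻¹' {g x}) :=
    hg.measurable (measurableSet_singleton _)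
  rw [dyadicAlgebra_eq] at hm
  obtain ⟨T, -, hT⟩ := hm
  have hx : x ∈ ix n ⁻¹' T := by rw [hT]; rfl
  have hy : y ∈ ix n ⁻¹' T := by
    show ix n y ∈ T
    rw [← h]; exact hx
  rw [hT] at hy
  exact hy.symm

lemma ix_left (n : ℕ) (k : ℤ) : ix n ((k : ℝ) / 2 ^ n) = k := by
  unfold ix
  rw [mul_div_cancel₀ _ (by positivity)]
  simp

/-- tree of a dyadic martingale -/
noncomputable def tree (f : ℕ → ℝ → X) (n : ℕ) (k : ℤ) : X :=
  f n (((k % 2 ^ n : ℤ) : ℝ) / 2 ^ n)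

lemma val_tree {f : ℕ → ℝ → X} (hf : ∀ n, StronglyMeasurable[dyadicAlgebra n] (f n)) (n : ℕ)
    {x : ℝ} (hx : x ∈ Set.Ico (0 : ℝ) 1) : val (tree f) n x = f n x := by
  unfold val tree
  apply const_on_cell (hf n)
  have := ix_mem n hx
  rw [ix_left, Int.emod_eq_of_lt this.1 this.2]

lemma tree_avg [CompleteSpace X] {f : ℕ → ℝ → X}
    (hf : Martingale f dyadicFiltration (volume.restrict (Set.Icc (0 : ℝ) 1))) :
    Avg (tree f) := by
  intro n k
  have hsm : ∀ n, StronglyMeasurable[dyadicAlgebra n] (f n) := hf.1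
  have hpos : (0 : ℤ) < 2 ^ n := by positivity
  set a := k % 2 ^ n with ha
  have ha' : 0 ≤ a ∧ a < 2 ^ n := ⟨Int.emod_nonneg k hpos.ne', Int.emod_lt_of_pos k hpos⟩
  have haa : a % 2 ^ n = k % 2 ^ n := by rw [ha, Int.emod_emod]
  have t0 : tree f n k = tree f n a := by unfold tree; rw [haa]
  have t1 : tree f (n + 1) (2 * k) = tree f (n + 1) (2 * a) := by
    unfold tree; rw [emod_even, emod_even, haa]
  have t2 : tree f (n + 1) (2 * k + 1) = tree f (n + 1) (2 * a + 1) := by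
    unfold tree; rw [emod_odd, emod_odd, haa]
  rw [t0, t1, t2]
  have hms : MeasurableSet[dyadicFiltration n] (ix n ⁻¹' {a}) :=
    ix_measurable n (measurableSet_singleton a)
  have hms0 : MeasurableSet (ix n ⁻¹' {a}) := dyadicFiltration.le n _ hms
  have h := hf.setIntegral_eq (Nat.le_succ n) hms
  rw [Measure.restrict_restrict hms0, Set.inter_eq_left.2
    ((cell_sub n a ha').trans Set.Ico_subset_Icc_self)] at h
  have hc : ∀ m, ∫ x in ix n ⁻¹' {a}, f m x = ∫ x in ix n ⁻¹' {a}, val (tree f) m x := by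
    intro m
    refine setIntegral_congr_fun hms0 fun x hx => ?_
    exact (val_tree hsm m (cell_sub n a ha' hx)).symm
  rw [hc, hc, setIntegral_cell, setIntegral_cell_succ _ _ _ ha'] at h
  have h2 := congrArg (fun z => (2 : ℝ) ^ (n + 1) • z) h
  simp only [smul_smul] at h2
  rw [mul_inv_cancel₀ (by positivity), one_smul, pow_succ', mul_assoc,
    mul_inv_cancel₀ (by positivity), mul_one, two_smul] at h2
  exact h2

end DyAz

theorem dyadic_moment_inequality_of_azuma_type
    {X : Type*} [NormedAddCommGroup X] [NormedSpace ℝ X] [CompleteSpace X]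
    (p K : ℝ) (hp1 : 1 < p) (hp2 : p ≤ 2) (hK : 0 < K)
    (hX : HasAzumaType X p K)
    (f : ℕ → ℝ → X)
    (hf : Martingale f dyadicFiltration (volume.restrict (Set.Icc (0 : ℝ) 1)))
    (r : ℝ) (hr : 1 ≤ r) :
    ∫⁻ ω, (⨆ j : ℕ, (‖f (j + 1) ω - f 0 ω‖₊ : ℝ≥0∞)) ^ r
        ∂(volume.restrict (Set.Icc (0 : ℝ) 1))
      ≤ ENNReal.ofReal (4 ^ (r + 1) * ((r + 2) * Real.log 2 * K) ^ (r / p)) *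
        ∫⁻ ω, (∑' j : ℕ, ENNReal.ofReal (‖f (j + 1) ω - f j ω‖ ^ p)) ^ (r / p)
          ∂(volume.restrict (Set.Icc (0 : ℝ) 1)) := by

  have hsm : ∀ n, StronglyMeasurable[dyadicAlgebra n] (f n) := hf.1
  have h := DyAz.tree_moment (by linarith : 0 < p) hK hX (DyAz.tree_avg hf) hr
  have hμ : (volume.restrict (Set.Icc (0 : ℝ) 1)) = volume.restrict (Set.Ico (0 : ℝ) 1) :=
    (Measure.restrict_congr_set Ico_ae_eq_Icc).symm
  rw [hμ]
  convert h using 1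
  · refine setLIntegral_congr_fun measurableSet_Ico fun x hx => ?_
    simp only [DyAz.Mx, DyAz.val_tree hsm _ hx]
  · congr 1
    refine setLIntegral_congr_fun measurableSet_Ico fun x hx => ?_
    simp only [DyAz.Q, DyAz.val_tree hsm _ hx]
end

section
/- Let X be a Banach space having Azuma type p for some 1 < p ≤ 2 (with some constant K > 0). Then X is linearly isomorphic to a p-uniformly smooth space; that is, there exist a norm ‖·‖′ on X equivalent to the original norm and a constant s > 0 such that the modulus of uniform smoothness of (X, ‖·‖′) satisfies ρ(τ) ≤ s·τ^p for all τ > 0. -/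
open MeasureTheory
open scoped ENNReal NNReal

lemma azt_final {X : Type*} [NormedAddCommGroup X] [NormedSpace ℝ X]
    (p : ℝ) (hp1 : 1 < p) (hp2 : p ≤ 2) (g : X → ℝ) (A : ℝ) (hA : 1 ≤ A)
    (h0 : ∀ x, 0 ≤ g x)
    (hs : ∀ (a : ℝ) (x : X), g (a • x) = |a| * g x)
    (ha : ∀ x y : X, g (x + y) ≤ g x + g y)
    (hlow : ∀ x, ‖x‖ ≤ A * g x)
    (hmid : ∀ m h : X, g (m + h) = 1 → g (m - h) = 1 → 1 - g m ≤ A * ‖h‖ ^ p) :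
    ∃ s : ℝ, 0 < s ∧ ∀ τ : ℝ, 0 < τ → ∀ x y : X, g x = 1 → g y = 1 →
        (g (x + τ • y) + g (x - τ • y)) / 2 - 1 ≤ s * τ ^ p := by
  have hpos : 0 < 3 * A * (6 * A) ^ p := by positivity
  have hneg : ∀ x, g (-x) = g x := fun x => by simpa using hs (-1) x
  have key : ∀ τ : ℝ, 0 < τ → τ ≤ 1 / 2 → ∀ x v : X, g x = 1 → g v = τ →
      g (x - v) ≤ g (x + v) → (g (x + v) + g (x - v)) / 2 - 1 ≤ 3 * A * (6 * A) ^ p * τ ^ p := by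
    intro τ hτ hτ2 x v hx hv hab
    have ha1 : g (x + v) ≤ 1 + τ := by simpa [hx, hv] using ha x v
    have hb1 : g (x - v) ≤ 1 + τ := by
      have := ha x (-v); rw [hneg, hx, hv, ← sub_eq_add_neg] at this; exact this
    have ha2 : 1 - τ ≤ g (x + v) := by
      have := ha (x + v) (-v); rw [hneg, hv, add_neg_cancel_right, hx] at this; linarith
    have hb2 : 1 - τ ≤ g (x - v) := by
      have := ha (x - v) v; rw [hv, sub_add_cancel, hx] at this; linarith
    have hab2 : 2 ≤ g (x + v) + g (x - v) := by
      have := ha (x + v) (x - v)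
      rw [show x + v + (x - v) = (2 : ℝ) • x by rw [two_smul]; abel, hs, hx] at this
      simpa using this
    have hdiff : g (x + v) - g (x - v) ≤ 2 * τ := by linarith
    set a := g (x + v) with hadef
    set b := g (x - v) with hbdef
    have hapos : 0 < a := by linarith
    have hbpos : 0 < b := by linarith
    -- unit vectors
    obtain ⟨y, hy⟩ : ∃ y, y = a⁻¹ • (x + v) := ⟨_, rfl⟩
    obtain ⟨z, hz⟩ : ∃ z, z = b⁻¹ • (x - v) := ⟨_, rfl⟩
    have hgy : g y = 1 := by
      rw [hy, hs, ← hadef, abs_of_pos (inv_pos.2 hapos)]; field_simp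
    have hgz : g z = 1 := by
      rw [hz, hs, ← hbdef, abs_of_pos (inv_pos.2 hbpos)]; field_simp
    obtain ⟨m, hm⟩ : ∃ m, m = (1 / 2 : ℝ) • (y + z) := ⟨_, rfl⟩
    obtain ⟨h, hh⟩ : ∃ h, h = (1 / 2 : ℝ) • (y - z) := ⟨_, rfl⟩
    have hmh : m + h = y := by rw [hm, hh]; module
    have hmh' : m - h = z := by rw [hm, hh]; module
    have h1 := hmid m h (by rw [hmh, hgy]) (by rw [hmh', hgz])
    -- bound on h
    have hhg : g h ≤ 6 * τ := by
      have e : h = (1 / 2 * (a⁻¹ - b⁻¹)) • x + (1 / 2 * (a⁻¹ + b⁻¹)) • v := by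
        rw [hh, hy, hz]; module
      have := ha ((1 / 2 * (a⁻¹ - b⁻¹)) • x) ((1 / 2 * (a⁻¹ + b⁻¹)) • v)
      rw [← e, hs, hs, hx, hv] at this
      have hai : a⁻¹ ≤ 2 := by
        rw [inv_le_comm₀ hapos (by norm_num)]; linarith
      have hbi : b⁻¹ ≤ 2 := by
        rw [inv_le_comm₀ hbpos (by norm_num)]; linarith
      have hai0 : 0 < a⁻¹ := inv_pos.2 hapos
      have hbi0 : 0 < b⁻¹ := inv_pos.2 hbpos
      have e1 : |1 / 2 * (a⁻¹ - b⁻¹)| ≤ 4 * τ := by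
        have : a⁻¹ - b⁻¹ = -((a - b) * (a⁻¹ * b⁻¹)) := by field_simp; ring
        rw [this, abs_mul, abs_neg, abs_of_nonneg (a := (a - b) * (a⁻¹ * b⁻¹))
          (mul_nonneg (by linarith) (by positivity))]
        have h4 : a⁻¹ * b⁻¹ ≤ 4 := by nlinarith
        have : (a - b) * (a⁻¹ * b⁻¹) ≤ (2 * τ) * 4 :=
          mul_le_mul hdiff h4 (by positivity) (by positivity)
        rw [abs_of_pos (by norm_num : (0 : ℝ) < 1 / 2)]
        linarith
      have e2 : |1 / 2 * (a⁻¹ + b⁻¹)| ≤ 2 := by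
        rw [abs_of_nonneg (by positivity)]; linarith
      have : |1 / 2 * (a⁻¹ + b⁻¹)| * τ ≤ 2 * τ := by gcongr
      linarith
    have hhn : ‖h‖ ≤ 6 * A * τ := by
      have := hlow h
      nlinarith [h0 h]
    have hhp : ‖h‖ ^ p ≤ (6 * A) ^ p * τ ^ p := by
      rw [← Real.mul_rpow (by positivity) hτ.le]
      exact Real.rpow_le_rpow (norm_nonneg _) hhn (by linarith)
    -- convexity
    have e : m = (1 / a) • x + (1 / 2 - b / (2 * a)) • z := by
      have hxv : x + v = a • y := by rw [hy, smul_smul, mul_inv_cancel₀ hapos.ne', one_smul]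
      have hxv' : x - v = b • z := by rw [hz, smul_smul, mul_inv_cancel₀ hbpos.ne', one_smul]
      have hx2 : x = (a / 2) • y + (b / 2) • z := by
        have : x = (1 / 2 : ℝ) • ((x + v) + (x - v)) := by module
        rw [this, hxv, hxv']; module
      rw [hm, hx2, smul_add, smul_add, smul_smul, smul_smul, add_assoc, ← add_smul]
      have c1 : 1 / a * (a / 2) = 1 / 2 := by field_simp
      have c2 : 1 / a * (b / 2) + (1 / 2 - b / (2 * a)) = 1 / 2 := by field_simp; ring
      rw [c1, c2]
    have hgm : g m ≤ 1 / a + (1 / 2 - b / (2 * a)) := by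
      have := ha ((1 / a) • x) ((1 / 2 - b / (2 * a)) • z)
      have c3 : 0 ≤ 1 / 2 - b / (2 * a) := by
        have : b / (2 * a) ≤ 1 / 2 := by rw [div_le_iff₀ (by positivity)]; linarith
        linarith
      rw [← e, hs, hs, hx, hgz, abs_of_pos (by positivity), abs_of_nonneg c3] at this
      linarith
    have h2 : (a + b - 2) / (2 * a) ≤ A * ((6 * A) ^ p * τ ^ p) := by
      have c : (a + b - 2) / (2 * a) = 1 - (1 / a + (1 / 2 - b / (2 * a))) := by
        field_simp; ring
      rw [c]
      have : A * ‖h‖ ^ p ≤ A * ((6 * A) ^ p * τ ^ p) := by gcongr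
      linarith
    rw [div_le_iff₀ (by positivity)] at h2
    have hnn : 0 ≤ A * ((6 * A) ^ p * τ ^ p) := by positivity
    nlinarith
  refine ⟨3 * A * (6 * A) ^ p + 2, by positivity, ?_⟩
  intro τ hτ x y hx hy
  have hv : g (τ • y) = τ := by rw [hs, hy, abs_of_pos hτ, mul_one]
  have hτp : 0 < τ ^ p := by positivity
  rcases le_total τ (1 / 2) with h | h
  · have : (g (x + τ • y) + g (x - τ • y)) / 2 - 1 ≤ 3 * A * (6 * A) ^ p * τ ^ p := by
      rcases le_total (g (x - τ • y)) (g (x + τ • y)) with h' | h'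
      · exact key τ hτ h x _ hx hv h'
      · have := key τ hτ h x (-(τ • y)) hx (by rw [hneg, hv])
          (by simpa [sub_eq_add_neg] using h')
        rw [sub_neg_eq_add, ← sub_eq_add_neg] at this
        linarith
    nlinarith
  · have h1 := ha x (τ • y)
    have h2 := ha x (-(τ • y))
    rw [hneg, ← sub_eq_add_neg] at h2
    rw [hx, hv] at h1 h2
    have h3 : τ ≤ 2 * τ ^ p := by
      rcases le_total τ 1 with h' | h'
      · have : τ ^ (2 : ℝ) ≤ τ ^ p := Real.rpow_le_rpow_of_exponent_ge hτ h' hp2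
        rw [Real.rpow_two] at this
        nlinarith
      · have := Real.rpow_le_rpow_of_exponent_le h' hp1.le
        rw [Real.rpow_one] at this
        linarith
    nlinarith

lemma azt_renorm {X : Type*} [NormedAddCommGroup X] [NormedSpace ℝ X]
    (p : ℝ) (hp1 : 1 < p) (hp2 : p ≤ 2) (U : X → ℝ) (D : ℝ) (hD : 0 ≤ D)
    (hconv : ConvexOn ℝ Set.univ U) (heven : ∀ x, U (-x) = U x)
    (hlip : ∀ x y, U x ≤ U y + ‖x - y‖) (hlow : ∀ x, ‖x‖ ≤ U x) (hup : ∀ x, U x ≤ ‖x‖ + D)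
    (hsm : ∀ x v, (U (x + v) + U (x - v)) / 2 ≤ Real.exp (‖v‖ ^ p) * U x) :
    ∃ g : X → ℝ,
      (∀ x, 0 ≤ g x) ∧ (∀ x, g x = 0 ↔ x = 0) ∧
      (∀ (a : ℝ) (x : X), g (a • x) = |a| * g x) ∧
      (∀ x y : X, g (x + y) ≤ g x + g y) ∧
      (∃ C₁ C₂ : ℝ, 0 < C₁ ∧ 0 < C₂ ∧ ∀ x : X, C₁ * ‖x‖ ≤ g x ∧ g x ≤ C₂ * ‖x‖) ∧
      (∃ s : ℝ, 0 < s ∧ ∀ τ : ℝ, 0 < τ → ∀ x y : X, g x = 1 → g y = 1 →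
        (g (x + τ • y) + g (x - τ • y)) / 2 - 1 ≤ s * τ ^ p) := by
  set A := D + 2 with hA
  set s : Set X := {x | U x < A} with hs
  have hcont : Continuous U := by
    have : LipschitzWith 1 U := LipschitzWith.of_dist_le_mul (fun x y => by
      rw [Real.dist_eq, dist_eq_norm, NNReal.coe_one, one_mul, abs_le]
      have h1 := hlip x y
      have h2 := hlip y x
      rw [norm_sub_rev] at h2
      constructor <;> linarith)
    exact this.continuous
  have hopen : IsOpen s := isOpen_lt hcont continuous_const
  have hball : Metric.ball (0 : X) 1 ⊆ s := by
    intro x hx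
    have : ‖x‖ < 1 := by simpa using hx
    have := hup x
    simp only [hs, Set.mem_ofPred_eq]
    linarith
  have hball' : s ⊆ Metric.closedBall (0 : X) A := by
    intro x hx
    have h1 : U x < A := hx
    simpa using (hlow x).trans h1.le
  have habs : Absorbent ℝ s := (absorbent_ball_zero one_pos).mono hball
  have hcvx : Convex ℝ s := by
    have := hconv.convex_lt A
    simpa [hs] using this
  have hsymm : ∀ x ∈ s, -x ∈ s := by
    intro x hx
    simpa [hs, heven] using hx
  have hnorm : ∀ x, ‖x‖ ≤ A * gauge s x := by
    intro x
    have := le_gauge_of_subset_closedBall (x := x) habs (by linarith : 0 ≤ A) hball'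
    rw [div_le_iff₀ (by linarith)] at this
    linarith
  have hnorm' : ∀ x, gauge s x ≤ ‖x‖ := by
    intro x
    simpa using mul_gauge_le_norm (x := x) hball
  have hsmul : ∀ (a : ℝ) (x : X), gauge s (a • x) = |a| * gauge s x := by
    intro a x
    rcases le_total 0 a with h | h
    · rw [gauge_smul_of_nonneg h, abs_of_nonneg h, smul_eq_mul]
    · rw [← gauge_neg hsymm, ← neg_smul, gauge_smul_of_nonneg (by linarith), abs_of_nonpos h,
        smul_eq_mul]
  have hadd := gauge_add_le hcvx habs
  refine ⟨gauge s, fun x => gauge_nonneg x, ?_, hsmul, hadd, ?_, ?_⟩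
  · intro x
    constructor
    · intro h
      have := hnorm x
      rw [h, mul_zero] at this
      exact norm_le_zero_iff.1 this
    · rintro rfl; exact gauge_zero
  · refine ⟨A⁻¹, 1, by positivity, one_pos, fun x => ⟨?_, by simpa using hnorm' x⟩⟩
    rw [inv_mul_le_iff₀ (by positivity)]
    exact hnorm x
  · refine azt_final p hp1 hp2 (gauge s) A (by linarith) (fun x => gauge_nonneg x) hsmul hadd hnorm ?_
    intro m h hy hz
    have hout : ∀ y, gauge s y = 1 → A ≤ U y := by
      intro y hy
      by_contra hcon
      have : y ∈ s := not_le.1 hcon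
      have := gauge_lt_one_of_mem_of_isOpen hopen this
      linarith
    have h1 := hsm m h
    have h2 := hout _ hy
    have h3 := hout _ hz
    have hhp : 0 ≤ ‖h‖ ^ p := by positivity
    rcases le_or_gt 1 (gauge s m) with hg | hg
    · have : 0 ≤ A * ‖h‖ ^ p := by positivity
      linarith
    have hU0 : U 0 ≤ D := by simpa using hup 0
    have h4 : U m ≤ A - (A - U 0) * (1 - gauge s m) := by
      have : ∀ ε : ℝ, 0 < ε → U m ≤ A - (A - U 0) * (1 - gauge s m) + ε := by
        intro ε hε
        obtain ⟨c, hc0, hc1, hc⟩ := exists_lt_of_gauge_lt habs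
          (show gauge s m < min 1 (gauge s m + ε / (A - U 0)) by
            refine lt_min hg ?_
            have : 0 < ε / (A - U 0) := div_pos hε (by linarith)
            linarith)
        obtain ⟨q, hq, rfl⟩ := hc
        have hq' : U q < A := hq
        have hc2 : c < 1 := hc1.trans_le (min_le_left _ _)
        have hc3 := hc1.trans_le (min_le_right _ _)
        have hcc := hconv.2 (Set.mem_univ q) (Set.mem_univ 0) hc0.le (by linarith : 0 ≤ 1 - c)
          (by ring)
        simp only [smul_zero, add_zero, smul_eq_mul] at hcc
        have : (c - gauge s (c • q)) * (A - U 0) ≤ ε := by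
          rw [← le_div_iff₀ (by linarith)]; linarith
        simp only at *
        nlinarith
      exact le_of_forall_pos_le_add this
    have h5 : A * Real.exp (-‖h‖ ^ p) ≤ U m := by
      rw [Real.exp_neg, ← div_eq_mul_inv, div_le_iff₀ (Real.exp_pos _)]
      linarith
    have h6 := Real.add_one_le_exp (-‖h‖ ^ p)
    have h7 : A * (-‖h‖ ^ p + 1) ≤ A * Real.exp (-‖h‖ ^ p) := by gcongr
    nlinarith
def aztSg (b : Bool) : ℝ := if b then 1 else -1

def aztExt {n : ℕ} (ω : Fin n → Bool) : ℕ → Bool := fun i => if h : i < n then ω ⟨i, h⟩ else false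

def aztCons (b : Bool) (ω : ℕ → Bool) : ℕ → Bool
  | 0 => b
  | i + 1 => ω i

noncomputable def aztEx (n : ℕ) (F : (ℕ → Bool) → ℝ) : ℝ :=
  ((2 : ℝ) ^ n)⁻¹ * ∑ ω : Fin n → Bool, F (aztExt ω)

def aztM {X : Type*} [NormedAddCommGroup X] [NormedSpace ℝ X] (v : ℕ → (ℕ → Bool) → X)
    (n : ℕ) (ω : ℕ → Bool) : X := ∑ j ∈ Finset.range n, aztSg (ω j) • v j ω

def aztNA {X : Type*} (v : ℕ → (ℕ → Bool) → X) : Prop :=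
  ∀ j ω ω', (∀ i < j, ω i = ω' i) → v j ω = v j ω'

def aztBud {X : Type*} [NormedAddCommGroup X] (p : ℝ) (v : ℕ → (ℕ → Bool) → X) (n : ℕ) (t : ℝ) :
    Prop := ∀ ω, ∑ j ∈ Finset.range n, ‖v j ω‖ ^ p ≤ t

def aztS {X : Type*} [NormedAddCommGroup X] [NormedSpace ℝ X] (p : ℝ) (n : ℕ) (x : X) (t : ℝ) :
    Set ℝ := {r | ∃ v : ℕ → (ℕ → Bool) → X, aztNA v ∧ aztBud p v n t ∧
      r = aztEx n (fun ω => ‖x + aztM v n ω‖)}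

noncomputable def aztB {X : Type*} [NormedAddCommGroup X] [NormedSpace ℝ X] (p : ℝ) (x : X)
    (t : ℝ) : ℝ := sSup {r | ∃ n, r ∈ aztS p n x t}

lemma aztEx_mono {n : ℕ} {F G : (ℕ → Bool) → ℝ} (h : ∀ ω, F ω ≤ G ω) : aztEx n F ≤ aztEx n G := by
  unfold aztEx
  gcongr with ω
  exact h _

lemma aztEx_add {n : ℕ} {F G : (ℕ → Bool) → ℝ} :
    aztEx n (fun ω => F ω + G ω) = aztEx n F + aztEx n G := by
  unfold aztEx
  rw [Finset.sum_add_distrib, mul_add]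

lemma aztEx_const_mul {n : ℕ} {F : (ℕ → Bool) → ℝ} (c : ℝ) :
    aztEx n (fun ω => c * F ω) = c * aztEx n F := by
  unfold aztEx
  rw [← Finset.mul_sum]; ring

lemma aztEx_const {n : ℕ} (c : ℝ) : aztEx n (fun _ => c) = c := by
  unfold aztEx
  simp

lemma aztExt_cons {n : ℕ} (b : Bool) (ω : Fin n → Bool) :
    aztExt (Fin.cons b ω : Fin (n + 1) → Bool) = aztCons b (aztExt ω) := by
  funext i
  cases i with
  | zero => simp [aztExt, aztCons]
  | succ i =>
    simp only [aztExt, aztCons, Nat.add_lt_add_iff_right]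
    split_ifs with h
    · exact Fin.cons_succ (α := fun _ => Bool) b ω ⟨i, h⟩
    · rfl

lemma aztEx_succ (n : ℕ) (F : (ℕ → Bool) → ℝ) :
    aztEx (n + 1) F = (aztEx n (fun ω => F (aztCons true ω)) +
      aztEx n (fun ω => F (aztCons false ω))) / 2 := by
  unfold aztEx
  rw [← (Fin.consEquiv (fun _ : Fin (n + 1) => Bool)).sum_comp, Fintype.sum_prod_type]
  have hc : ∀ (b : Bool) (ω : Fin n → Bool),
      aztExt ((Fin.consEquiv (fun _ : Fin (n + 1) => Bool)) (b, ω)) = aztCons b (aztExt ω) :=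
    fun b ω => aztExt_cons b ω
  simp only [hc, Fintype.sum_bool]
  rw [pow_succ]
  field_simp

def aztCat {X : Type*} (u : X) (v : Bool → ℕ → (ℕ → Bool) → X) : ℕ → (ℕ → Bool) → X
  | 0, _ => u
  | j + 1, ω => v (ω 0) j (fun i => ω (i + 1))

section
variable {X : Type*} [NormedAddCommGroup X] [NormedSpace ℝ X]

lemma aztCat_NA (u : X) (v : Bool → ℕ → (ℕ → Bool) → X) (hv : ∀ b, aztNA (v b)) :
    aztNA (aztCat u v) := by
  intro j ω ω' h
  cases j with
  | zero => rfl
  | succ j =>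
    simp only [aztCat]
    rw [h 0 (by omega)]
    exact hv _ j _ _ (fun i hi => h (i + 1) (by omega))

lemma aztCat_bud (p : ℝ) (n : ℕ) (t : ℝ) (u : X) (v : Bool → ℕ → (ℕ → Bool) → X)
    (hv : ∀ b, aztBud p (v b) n t) : aztBud p (aztCat u v) (n + 1) (t + ‖u‖ ^ p) := by
  intro ω
  rw [Finset.sum_range_succ']
  have := hv (ω 0) (fun i => ω (i + 1))
  simp only [aztCat]
  linarith

lemma aztCat_M (n : ℕ) (u : X) (v : Bool → ℕ → (ℕ → Bool) → X) (b : Bool) (ω : ℕ → Bool) :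
    aztM (aztCat u v) (n + 1) (aztCons b ω) = aztSg b • u + aztM (v b) n ω := by
  unfold aztM
  rw [Finset.sum_range_succ', add_comm]
  rfl

lemma aztS_cat (p : ℝ) (n : ℕ) (x u : X) (t r₁ r₂ : ℝ)
    (h₁ : r₁ ∈ aztS p n (x + u) t) (h₂ : r₂ ∈ aztS p n (x - u) t) :
    (r₁ + r₂) / 2 ∈ aztS p (n + 1) x (t + ‖u‖ ^ p) := by
  obtain ⟨v₁, hn₁, hb₁, rfl⟩ := h₁
  obtain ⟨v₂, hn₂, hb₂, rfl⟩ := h₂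
  refine ⟨aztCat u (fun b => if b then v₁ else v₂), aztCat_NA _ _ ?_, aztCat_bud _ _ _ _ _ ?_, ?_⟩
  · intro b; cases b <;> simpa
  · intro b; cases b <;> simpa
  · rw [aztEx_succ]
    simp only [aztCat_M, aztSg, if_true, one_smul, ← add_assoc]
    simp [sub_eq_add_neg]

lemma aztS_succ (p : ℝ) (hp : 1 < p) (n : ℕ) (x : X) (t r : ℝ)
    (h : r ∈ aztS p n x t) : r ∈ aztS p (n + 1) x t := by
  have := aztS_cat p n x 0 t r r (by simpa) (by simpa)
  simpa [Real.zero_rpow (by linarith : p ≠ 0)] using this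

lemma aztS_le (p : ℝ) (hp : 1 < p) {n m : ℕ} (hnm : n ≤ m) (x : X) (t r : ℝ)
    (h : r ∈ aztS p n x t) : r ∈ aztS p m x t := by
  induction m, hnm using Nat.le_induction with
  | base => exact h
  | succ m _ ih => exact aztS_succ p hp m x t r ih

lemma aztS_bdd {p D : ℝ}
    (hbd : ∀ (n : ℕ) (v : ℕ → (ℕ → Bool) → X) (t : ℝ), 0 ≤ t → aztNA v → aztBud p v n t →
      aztEx n (fun ω => ‖aztM v n ω‖) ≤ D * (1 + t)) (x : X) {t : ℝ} (ht : 0 ≤ t) (n : ℕ) (r : ℝ)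
    (h : r ∈ aztS p n x t) : r ≤ ‖x‖ + D * (1 + t) := by
  obtain ⟨v, hn, hb, rfl⟩ := h
  calc _ ≤ aztEx n (fun ω => ‖x‖ + ‖aztM v n ω‖) := aztEx_mono (fun ω => norm_add_le _ _)
    _ = ‖x‖ + aztEx n (fun ω => ‖aztM v n ω‖) := by rw [aztEx_add, aztEx_const]
    _ ≤ _ := by have := hbd n v t ht hn hb; linarith

lemma aztS_zero (p : ℝ) (x : X) {t : ℝ} (ht : 0 ≤ t) : ‖x‖ ∈ aztS p 0 x t := by
  refine ⟨fun _ _ => 0, fun _ _ _ _ => rfl, fun ω => by simpa using ht, ?_⟩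
  simp [aztM, aztEx_const]

lemma aztB_le (p : ℝ) (x : X) {t c : ℝ} (ht : 0 ≤ t) (h : ∀ n, ∀ r ∈ aztS p n x t, r ≤ c) :
    aztB p x t ≤ c :=
  csSup_le ⟨_, 0, aztS_zero p x ht⟩ (by rintro r ⟨n, hr⟩; exact h n r hr)

lemma azt_main_B (p : ℝ) (hp1 : 1 < p) (hp2 : p ≤ 2) (D : ℝ) (hD : 0 ≤ D)
    (hbd : ∀ (n : ℕ) (v : ℕ → (ℕ → Bool) → X) (t : ℝ), 0 ≤ t → aztNA v → aztBud p v n t →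
      aztEx n (fun ω => ‖aztM v n ω‖) ≤ D * (1 + t)) :
    ∃ g : X → ℝ,
      (∀ x, 0 ≤ g x) ∧ (∀ x, g x = 0 ↔ x = 0) ∧
      (∀ (a : ℝ) (x : X), g (a • x) = |a| * g x) ∧
      (∀ x y : X, g (x + y) ≤ g x + g y) ∧
      (∃ C₁ C₂ : ℝ, 0 < C₁ ∧ 0 < C₂ ∧ ∀ x : X, C₁ * ‖x‖ ≤ g x ∧ g x ≤ C₂ * ‖x‖) ∧
      (∃ s : ℝ, 0 < s ∧ ∀ τ : ℝ, 0 < τ → ∀ x y : X, g x = 1 → g y = 1 →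
        (g (x + τ • y) + g (x - τ • y)) / 2 - 1 ≤ s * τ ^ p) := by
  have hmem : ∀ (x : X) (t : ℝ), 0 ≤ t → ∀ n, ∀ r ∈ aztS p n x t, r ≤ aztB p x t := by
    intro x t ht n r hr
    refine le_csSup ⟨‖x‖ + D * (1 + t), ?_⟩ ⟨n, hr⟩
    rintro r ⟨n, hr⟩
    exact aztS_bdd hbd x ht n r hr
  have hBlow : ∀ (x : X) (t : ℝ), 0 ≤ t → ‖x‖ ≤ aztB p x t := fun x t ht =>
    hmem x t ht 0 _ (aztS_zero p x ht)
  have hBup : ∀ (x : X) (t : ℝ), 0 ≤ t → aztB p x t ≤ ‖x‖ + D * (1 + t) := fun x t ht =>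
    aztB_le p x ht (aztS_bdd hbd x ht)
  have hBmono : ∀ x : X, MonotoneOn (aztB p x) (Set.Ioi 0) := by
    intro x t ht t' ht' htt
    refine aztB_le p x (le_of_lt ht) (fun n r hr => hmem x t' (le_of_lt ht') n r ?_)
    obtain ⟨v, hn, hb, rfl⟩ := hr
    exact ⟨v, hn, fun ω => (hb ω).trans htt, rfl⟩
  have hBneg : ∀ (x : X) (t : ℝ), 0 ≤ t → aztB p (-x) t ≤ aztB p x t := by
    intro x t ht
    refine aztB_le p _ ht (fun n r hr => hmem x t ht n r ?_)
    obtain ⟨v, hn, hb, rfl⟩ := hr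
    refine ⟨fun j ω => - v j ω, fun j ω ω' h => congrArg Neg.neg (hn j ω ω' h), fun ω => by simpa using hb ω, ?_⟩
    congr 1
    funext ω
    rw [← norm_neg]
    congr 1
    simp [aztM, add_comm]
  have hBlip : ∀ (x y : X) (t : ℝ), 0 ≤ t → aztB p x t ≤ aztB p y t + ‖x - y‖ := by
    intro x y t ht
    refine aztB_le p _ ht (fun n r hr => ?_)
    obtain ⟨v, hn, hb, rfl⟩ := hr
    have h1 := hmem y t ht n _ ⟨v, hn, hb, rfl⟩
    have h2 : aztEx n (fun ω => ‖x + aztM v n ω‖) ≤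
        aztEx n (fun ω => ‖y + aztM v n ω‖ + ‖x - y‖) := aztEx_mono (fun ω => by
      have := norm_add_le (y + aztM v n ω) (x - y)
      rwa [show y + aztM v n ω + (x - y) = x + aztM v n ω by abel] at this)
    rw [aztEx_add, aztEx_const] at h2
    linarith
  have hBconv : ∀ (x y : X) (a b t : ℝ), 0 ≤ t → 0 ≤ a → 0 ≤ b → a + b = 1 →
      aztB p (a • x + b • y) t ≤ a * aztB p x t + b * aztB p y t := by
    intro x y a b t ht ha hb hab
    refine aztB_le p _ ht (fun n r hr => ?_)
    obtain ⟨v, hn, hbu, rfl⟩ := hr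
    have h1 := hmem x t ht n _ ⟨v, hn, hbu, rfl⟩
    have h2 := hmem y t ht n _ ⟨v, hn, hbu, rfl⟩
    have h3 : aztEx n (fun ω => ‖a • x + b • y + aztM v n ω‖) ≤
        aztEx n (fun ω => a * ‖x + aztM v n ω‖ + b * ‖y + aztM v n ω‖) := aztEx_mono (fun ω => by
      have := norm_add_le (a • (x + aztM v n ω)) (b • (y + aztM v n ω))
      rw [norm_smul, norm_smul, Real.norm_of_nonneg ha, Real.norm_of_nonneg hb] at this
      have e : a • (x + aztM v n ω) + b • (y + aztM v n ω) = a • x + b • y + aztM v n ω := by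
        have : aztM v n ω = (a + b) • aztM v n ω := by rw [hab, one_smul]
        conv_rhs => rw [this]
        module
      rwa [e] at this)
    rw [aztEx_add, aztEx_const_mul, aztEx_const_mul] at h3
    have h4 := mul_le_mul_of_nonneg_left h1 ha
    have h5 := mul_le_mul_of_nonneg_left h2 hb
    linarith
  have hBsm : ∀ (x u : X) (t : ℝ), 0 ≤ t →
      (aztB p (x + u) t + aztB p (x - u) t) / 2 ≤ aztB p x (t + ‖u‖ ^ p) := by
    intro x u t ht
    have hts : 0 ≤ t + ‖u‖ ^ p := by positivity
    have h1 : aztB p (x + u) t ≤ 2 * aztB p x (t + ‖u‖ ^ p) - aztB p (x - u) t := by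
      refine aztB_le p _ ht (fun n r hr => ?_)
      have h2 : aztB p (x - u) t ≤ 2 * aztB p x (t + ‖u‖ ^ p) - r := by
        refine aztB_le p _ ht (fun m r' hr' => ?_)
        have := hmem x _ hts _ _ (aztS_cat p (max n m) x u t r r'
          (aztS_le p hp1 (le_max_left _ _) _ _ _ hr) (aztS_le p hp1 (le_max_right _ _) _ _ _ hr'))
        linarith
      linarith
    linarith
  -- the integrated functional
  have hi1 : IntegrableOn (fun t : ℝ => Real.exp (-t)) (Set.Ioi 0) := by
    simpa using integrableOn_exp_mul_Ioi (a := -1) (by norm_num) 0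
  have hi2 : IntegrableOn (fun t : ℝ => Real.exp (-(1 / 2) * t)) (Set.Ioi 0) :=
    integrableOn_exp_mul_Ioi (a := -(1 / 2)) (by norm_num) 0
  have hv1 : ∫ t in Set.Ioi (0 : ℝ), Real.exp (-t) = 1 := by
    simpa using integral_exp_mul_Ioi (a := -1) (by norm_num) 0
  have hv2 : ∫ t in Set.Ioi (0 : ℝ), Real.exp (-(1 / 2) * t) = 2 := by
    rw [integral_exp_mul_Ioi (a := -(1 / 2)) (by norm_num) 0]
    norm_num
  have hdom : ∀ (x : X) (t : ℝ), 0 < t → aztB p x t * Real.exp (-t) ≤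
      ‖x‖ * Real.exp (-t) + 2 * D * Real.exp (-(1 / 2) * t) := by
    intro x t ht
    have h1 := mul_le_mul_of_nonneg_right (hBup x t ht.le) (Real.exp_pos (-t)).le
    have h2 : (1 + t) * Real.exp (-t) ≤ 2 * Real.exp (-(1 / 2) * t) := by
      have e : Real.exp (-(1 / 2) * t) = Real.exp ((1 / 2) * t) * Real.exp (-t) := by
        rw [← Real.exp_add]; congr 1; ring
      rw [e, ← mul_assoc]
      refine mul_le_mul_of_nonneg_right ?_ (Real.exp_pos _).le
      have := Real.add_one_le_exp ((1 / 2) * t)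
      linarith
    have h3 := mul_le_mul_of_nonneg_left h2 hD
    linarith
  have hint : ∀ x : X, IntegrableOn (fun t => aztB p x t * Real.exp (-t)) (Set.Ioi 0) := by
    intro x
    refine Integrable.mono' ((hi1.const_mul ‖x‖).add (hi2.const_mul (2 * D))) ?_ ?_
    · refine AEMeasurable.aestronglyMeasurable (AEMeasurable.mul ?_ (by fun_prop))
      exact aemeasurable_restrict_of_monotoneOn measurableSet_Ioi (hBmono x)
    · refine (ae_restrict_iff' measurableSet_Ioi).2 (Filter.Eventually.of_forall fun t ht => ?_)
      have ht' : 0 < t := ht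
      rw [Real.norm_of_nonneg]
      · exact hdom x t ht'
      · exact mul_nonneg ((norm_nonneg x).trans (hBlow x t ht'.le)) (Real.exp_pos _).le
  set U : X → ℝ := fun x => ∫ t in Set.Ioi (0 : ℝ), aztB p x t * Real.exp (-t) with hU
  refine azt_renorm p hp1 hp2 U (4 * D) (by positivity) ⟨convex_univ, ?_⟩ ?_ ?_ ?_ ?_ ?_
  · intro x _ y _ a b ha hb hab
    simp only [hU, smul_eq_mul]
    rw [← integral_const_mul, ← integral_const_mul,
      ← integral_add ((hint x).const_mul a) ((hint y).const_mul b)]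
    refine setIntegral_mono_on (hint _) (((hint x).const_mul a).add ((hint y).const_mul b))
      measurableSet_Ioi (fun t ht => ?_)
    have := mul_le_mul_of_nonneg_right (hBconv x y a b t (le_of_lt ht) ha hb hab)
      (Real.exp_pos (-t)).le
    linarith
  · intro x
    simp only [hU]
    refine setIntegral_congr_fun measurableSet_Ioi (fun t ht => ?_)
    have h1 := hBneg x t (le_of_lt ht)
    have h2 := hBneg (-x) t (le_of_lt ht)
    rw [neg_neg] at h2
    simp only [le_antisymm h1 h2]
  · intro x y
    have e : ‖x - y‖ = ∫ t in Set.Ioi (0 : ℝ), ‖x - y‖ * Real.exp (-t) := by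
      rw [integral_const_mul, hv1, mul_one]
    rw [e]
    simp only [hU]
    rw [← integral_add (hint y) (hi1.const_mul _)]
    refine setIntegral_mono_on (hint _) ((hint y).add (hi1.const_mul _))
      measurableSet_Ioi (fun t ht => ?_)
    have := mul_le_mul_of_nonneg_right (hBlip x y t (le_of_lt ht)) (Real.exp_pos (-t)).le
    linarith
  · intro x
    have e : ‖x‖ = ∫ t in Set.Ioi (0 : ℝ), ‖x‖ * Real.exp (-t) := by
      rw [integral_const_mul, hv1, mul_one]
    rw [e]
    refine setIntegral_mono_on (hi1.const_mul _) (hint x) measurableSet_Ioi (fun t ht => ?_)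
    exact mul_le_mul_of_nonneg_right (hBlow x t (le_of_lt ht)) (Real.exp_pos (-t)).le
  · intro x
    have e : ‖x‖ + 4 * D = ∫ t in Set.Ioi (0 : ℝ),
        (‖x‖ * Real.exp (-t) + 2 * D * Real.exp (-(1 / 2) * t)) := by
      rw [integral_add (hi1.const_mul _) (hi2.const_mul _), integral_const_mul, hv1, mul_one,
        integral_const_mul, hv2]
      ring
    rw [e]
    exact setIntegral_mono_on (hint x) ((hi1.const_mul _).add (hi2.const_mul _))
      measurableSet_Ioi (fun t ht => hdom x t ht)
  · intro x v
    set s := ‖v‖ ^ p with hs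
    have hs0 : 0 ≤ s := by positivity
    have hemb := (measurableEmbedding_addRight s : MeasurableEmbedding (fun t : ℝ => t + s))
    have hmp := measurePreserving_add_right (volume : Measure ℝ) s
    have hpre : (fun t : ℝ => t + s) ⁻¹' (Set.Ioi s) = Set.Ioi 0 := by
      ext t; simp
    have e1 := hmp.setIntegral_preimage_emb hemb (fun t => aztB p x t * Real.exp (-t)) (Set.Ioi s)
    have i1 := (hmp.integrableOn_comp_preimage hemb (f := fun t => aztB p x t * Real.exp (-t))
      (s := Set.Ioi s)).2 ((hint x).mono_set (Set.Ioi_subset_Ioi hs0))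
    rw [hpre] at e1 i1
    have e2 : ∫ t in Set.Ioi s, aztB p x t * Real.exp (-t) ≤ U x := by
      refine setIntegral_mono_set (hint x) ?_ (Set.Ioi_subset_Ioi hs0).eventuallyLE
      refine (ae_restrict_iff' measurableSet_Ioi).2 (Filter.Eventually.of_forall fun t ht => ?_)
      exact mul_nonneg ((norm_nonneg x).trans (hBlow x t (le_of_lt ht))) (Real.exp_pos _).le
    have e3 : (U (x + v) + U (x - v)) / 2 = ∫ t in Set.Ioi (0 : ℝ),
        (1 / 2) * (aztB p (x + v) t * Real.exp (-t) + aztB p (x - v) t * Real.exp (-t)) := by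
      rw [integral_const_mul, integral_add (hint _) (hint _)]
      simp only [hU]; ring
    have e4 : Real.exp s * U x ≥ ∫ t in Set.Ioi (0 : ℝ),
        Real.exp s * (aztB p x (t + s) * Real.exp (-(t + s))) := by
      rw [integral_const_mul, e1]
      exact mul_le_mul_of_nonneg_left e2 (Real.exp_pos _).le
    rw [e3]
    refine le_trans ?_ e4
    refine setIntegral_mono_on (((hint _).add (hint _)).const_mul _) (i1.const_mul _)
      measurableSet_Ioi (fun t ht => ?_)
    have h1 := mul_le_mul_of_nonneg_right (hBsm x v t (le_of_lt ht)) (Real.exp_pos (-t)).le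
    have h2 : Real.exp s * (aztB p x (t + s) * Real.exp (-(t + s))) =
        aztB p x (t + s) * Real.exp (-t) := by
      rw [mul_left_comm, ← Real.exp_add]; congr 2; ring
    rw [h2]
    linarith

end

def aztFilt (n : ℕ) : Filtration ℕ (MeasurableSpace.pi : MeasurableSpace (Fin n → Bool)) where
  seq j :=
    { MeasurableSet' := fun A => ∀ ω ω' : Fin n → Bool,
        (∀ i : Fin n, i.1 < j → ω i = ω' i) → ω ∈ A → ω' ∈ A
      measurableSet_empty := fun _ _ _ h => h
      measurableSet_compl := fun A hA ω ω' h hω hω' => hω (hA ω' ω (fun i hi => (h i hi).symm) hω')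
      measurableSet_iUnion := fun A hA ω ω' h hω => by
        obtain ⟨k, hk⟩ := Set.mem_iUnion.1 hω
        exact Set.mem_iUnion.2 ⟨k, hA k ω ω' h hk⟩ }
  mono' := fun j k hjk A hA ω ω' h => hA ω ω' (fun i hi => h i (lt_of_lt_of_le hi hjk))
  le' := fun j A _ => Set.Finite.measurableSet (Set.toFinite A)

lemma aztFilt_zero (n : ℕ) : (aztFilt n) 0 = ⊥ := by
  refine le_antisymm (fun A hA => ?_) bot_le
  rw [MeasurableSpace.measurableSet_bot_iff]
  rcases A.eq_empty_or_nonempty with h | ⟨ω, hω⟩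
  · exact Or.inl h
  · exact Or.inr (Set.eq_univ_of_forall fun ω' => hA ω ω' (fun i hi => absurd hi (by omega)) hω)

lemma aztFilt_sm {Y : Type*} [TopologicalSpace Y] (n j : ℕ) (F : (Fin n → Bool) → Y)
    (hF : ∀ ω ω', (∀ i : Fin n, i.1 < j → ω i = ω' i) → F ω = F ω') :
    StronglyMeasurable[(aztFilt n) j] F := by
  let G : @SimpleFunc (Fin n → Bool) ((aztFilt n) j) Y :=
    @SimpleFunc.mk _ ((aztFilt n) j) _ F
      (fun y ω ω' h hω => by
        have : F ω = y := hω
        show F ω' = y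
        rw [← hF ω ω' h, this])
      (Set.finite_range F)
  exact @SimpleFunc.stronglyMeasurable _ _ ((aztFilt n) j) _ G

noncomputable def aztMu (n : ℕ) : Measure (Fin n → Bool) := ((2 : ℝ≥0∞) ^ n)⁻¹ • Measure.count

lemma aztMu_prob (n : ℕ) : IsProbabilityMeasure (aztMu n) := by
  constructor
  simp only [aztMu, Measure.smul_apply, smul_eq_mul]
  rw [Measure.count_univ]
  simp
  exact ENNReal.inv_mul_cancel (by simp) (by simp)

lemma aztMu_real (n : ℕ) (ω : Fin n → Bool) : (aztMu n).real {ω} = ((2 : ℝ) ^ n)⁻¹ := by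
  simp [Measure.real, aztMu, Measure.smul_apply]

lemma aztExt_eq {n j : ℕ} (hj : j ≤ n) {ω ω' : Fin n → Bool}
    (h : ∀ i : Fin n, i.1 < j → ω i = ω' i) : ∀ i < j, aztExt ω i = aztExt ω' i := by
  intro i hi
  have : i < n := by omega
  simp only [aztExt, this, dif_pos]
  exact h ⟨i, this⟩ hi

lemma aztM_eq {X : Type*} [NormedAddCommGroup X] [NormedSpace ℝ X]
    {v : ℕ → (ℕ → Bool) → X} (hv : aztNA v) {j : ℕ} {ω ω' : ℕ → Bool}
    (h : ∀ i < j, ω i = ω' i) : aztM v j ω = aztM v j ω' := by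
  refine Finset.sum_congr rfl (fun i hi => ?_)
  rw [Finset.mem_range] at hi
  rw [h i hi, hv i ω ω' (fun k hk => h k (by omega))]

lemma aztMart {X : Type*} [NormedAddCommGroup X] [NormedSpace ℝ X] [CompleteSpace X]
    {v : ℕ → (ℕ → Bool) → X} (hv : aztNA v) (n : ℕ) :
    Martingale (fun j (ω : Fin n → Bool) => aztM v (min j n) (aztExt ω)) (aztFilt n) (aztMu n) := by
  have := aztMu_prob n
  refine martingale_of_setIntegral_eq_succ ?_ (fun i => Integrable.of_finite) ?_
  · intro j
    refine aztFilt_sm n j _ (fun ω ω' h => aztM_eq hv (aztExt_eq (min_le_right _ _) ?_))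
    exact fun i hi => h i (by omega)
  · intro i s hs
    rcases le_or_gt n i with hi | hi
    · rw [min_eq_right hi, min_eq_right (by omega)]
    · rw [min_eq_left hi.le, min_eq_left (by omega : i + 1 ≤ n)]
      have hm : MeasurableSet s := (aztFilt n).le i s hs
      have e : ∀ ω : Fin n → Bool, aztM v (i + 1) (aztExt ω) =
          aztM v i (aztExt ω) + aztSg (aztExt ω i) • v i (aztExt ω) := fun ω => by
        unfold aztM; rw [Finset.sum_range_succ]
      simp only [e]
      rw [integral_add Integrable.of_finite.integrableOn Integrable.of_finite.integrableOn]
      have hz : ∫ ω in s, aztSg (aztExt ω i) • v i (aztExt ω) ∂(aztMu n) = 0 := by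
        rw [← integral_indicator hm, integral_fintype Integrable.of_finite]
        simp only [aztMu_real]
        rw [← Finset.smul_sum]
        set g := s.indicator (fun ω : Fin n → Bool => aztSg (aztExt ω i) • v i (aztExt ω)) with hg
        have hinv : Function.Involutive
            (fun ω : Fin n → Bool => Function.update ω ⟨i, hi⟩ (!(ω ⟨i, hi⟩))) := by
          intro ω; simp
        have hagree : ∀ ω : Fin n → Bool, ∀ k : Fin n, k.1 < i →
            Function.update ω ⟨i, hi⟩ (!(ω ⟨i, hi⟩)) k = ω k := by
          intro ω k hk
          rw [Function.update_of_ne]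
          rintro rfl; simp at hk
        have hflip : ∀ ω, g (hinv.toPerm _ ω) = - g ω := by
          intro ω
          rw [Function.Involutive.coe_toPerm]
          simp only [hg]
          have hmem : Function.update ω ⟨i, hi⟩ (!(ω ⟨i, hi⟩)) ∈ s ↔ ω ∈ s :=
            ⟨hs _ _ (hagree ω), hs _ _ (fun k hk => (hagree ω k hk).symm)⟩
          by_cases hω : ω ∈ s
          · rw [Set.indicator_of_mem (hmem.2 hω), Set.indicator_of_mem hω,
              hv i _ (aztExt ω) (aztExt_eq hi.le (hagree ω)), ← neg_smul]
            congr 1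
            simp only [aztExt, hi, dif_pos, Function.update_self]
            cases ω ⟨i, hi⟩ <;> simp [aztSg]
          · rw [Set.indicator_of_notMem (fun h => hω (hmem.1 h)), Set.indicator_of_notMem hω,
              neg_zero]
        have h1 := Equiv.sum_comp (hinv.toPerm _) g
        simp only [hflip, Finset.sum_neg_distrib] at h1
        have h2 : ∑ ω, g ω = 0 := by
          have : (2 : ℝ) • ∑ ω, g ω = 0 := by
            rw [two_smul]; nth_rewrite 1 [← h1]; exact neg_add_cancel _
          exact (smul_eq_zero.1 this).resolve_left (by norm_num)
        rw [h2, smul_zero]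
      rw [hz, add_zero]

lemma azt_tail {X : Type*} [NormedAddCommGroup X] [NormedSpace ℝ X] [CompleteSpace X]
    (p K : ℝ) (hp1 : 1 < p) (hK : 0 < K) (hX : HasAzumaType X p K)
    (n : ℕ) (v : ℕ → (ℕ → Bool) → X) (t : ℝ) (ht : 0 ≤ t) (hv : aztNA v) (hb : aztBud p v n t)
    (r : ℝ) (hr : 0 < r) :
    (aztMu n).real {ω | r ≤ ‖aztM v n (aztExt ω)‖} ≤
      2 * Real.exp (-(r ^ p) / (K * (1 + t))) := by
  have := aztMu_prob n
  set w : ℕ → (Fin n → Bool) → ℝ := fun k ω =>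
    if k - 1 < n then ‖v (k - 1) (aztExt ω)‖ else if k - 1 = n then 1 else 0 with hw
  have hw1 : ∀ j < n, ∀ ω, w (j + 1) ω = ‖v j (aztExt ω)‖ := by
    intro j hj ω; simp [hw, hj]
  have hw2 : ∀ ω, w (n + 1) ω = 1 := by
    intro ω; simp [hw]
  have hw3 : ∀ j, n < j → ∀ ω, w (j + 1) ω = 0 := by
    intro j hj ω; simp [hw, not_lt.2 hj.le, hj.ne']
  have hw0 : ∀ j ω, 0 ≤ w (j + 1) ω := by
    intro j ω
    simp only [hw]
    split_ifs <;> positivity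
  have hmain := hX (Fin n → Bool) _ (aztMu n) (aztMu_prob n) (aztFilt n) (aztFilt_zero n) _
    (aztMart hv n) w hw0 ?_ ?_ r hr
  · have hsum : ∀ ω, ∑' j : ℕ, ENNReal.ofReal (w (j + 1) ω ^ p) =
        ENNReal.ofReal (∑ j ∈ Finset.range n, ‖v j (aztExt ω)‖ ^ p) + 1 := by
      intro ω
      rw [tsum_eq_sum (s := Finset.range (n + 1)), Finset.sum_range_succ, hw2, Real.one_rpow,
        ENNReal.ofReal_one, ENNReal.ofReal_sum_of_nonneg (fun _ _ => by positivity)]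
      · congr 1
        refine Finset.sum_congr rfl (fun j hj => ?_)
        rw [hw1 j (Finset.mem_range.1 hj)]
      · intro j hj
        rw [hw3 j (by simp at hj; omega), Real.zero_rpow (by linarith), ENNReal.ofReal_zero]
    simp only [hsum] at hmain
    set S := essSup (fun ω : Fin n → Bool =>
      ENNReal.ofReal (∑ j ∈ Finset.range n, ‖v j (aztExt ω)‖ ^ p) + 1) (aztMu n) with hS
    have hS1 : S ≤ ENNReal.ofReal (1 + t) := by
      refine essSup_le_of_ae_le _ (Filter.Eventually.of_forall fun ω => ?_)
      rw [add_comm 1 t, ENNReal.ofReal_add ht (by norm_num), ENNReal.ofReal_one]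
      exact add_le_add (ENNReal.ofReal_le_ofReal (hb _)) le_rfl
    have hS2 : 1 ≤ S := by
      have h1 : essSup (fun _ : Fin n → Bool => (1 : ℝ≥0∞)) (aztMu n) = 1 :=
        essSup_const _ (IsProbabilityMeasure.ne_zero _)
      rw [← h1]
      exact essSup_mono_ae (Filter.Eventually.of_forall fun ω => le_add_self)
    have hS3 : S.toReal ≤ 1 + t := ENNReal.toReal_le_of_le_ofReal (by linarith) hS1
    have hS4 : 1 ≤ S.toReal := by
      have hfin : S ≠ ⊤ := ne_top_of_le_ne_top ENNReal.ofReal_ne_top hS1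
      simpa using ENNReal.toReal_mono hfin hS2
    have hsub : {ω : Fin n → Bool | r ≤ ‖aztM v n (aztExt ω)‖} ⊆
        {ω | ENNReal.ofReal r ≤ ⨆ j : ℕ, (‖aztM v (min (j + 1) n) (aztExt ω) -
          aztM v (min 0 n) (aztExt ω)‖₊ : ℝ≥0∞)} := by
      intro ω hω
      have hω' : r ≤ ‖aztM v n (aztExt ω)‖ := hω
      rw [Set.mem_ofPred_eq]
      refine le_trans ?_ (le_iSup _ n)
      rw [min_eq_right (by omega : n ≤ n + 1), min_eq_left (by omega : 0 ≤ n)]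
      have h0 : aztM v 0 (aztExt ω) = 0 := by simp [aztM]
      rw [h0, sub_zero, ← ENNReal.ofReal_coe_nnreal, coe_nnnorm]
      exact ENNReal.ofReal_le_ofReal hω'
    have h1 := (measure_mono hsub).trans hmain
    have h2 := ENNReal.toReal_le_of_le_ofReal (by positivity) h1
    refine h2.trans ?_
    gcongr 2 * Real.exp ?_
    rw [neg_div, neg_div, neg_le_neg_iff]
    gcongr
  · intro j
    refine aztFilt_sm n j _ (fun ω ω' h => ?_)
    rcases lt_or_ge j n with hj | hj
    · rw [hw1 j hj, hw1 j hj, hv j _ _ (aztExt_eq hj.le h)]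
    · simp [hw, not_lt.2 hj]
  · intro j
    refine Filter.Eventually.of_forall fun ω => ?_
    rcases lt_or_ge j n with hj | hj
    · rw [hw1 j hj]
      rw [min_eq_left hj.le, min_eq_left (by omega : j + 1 ≤ n)]
      unfold aztM
      rw [Finset.sum_range_succ, add_sub_cancel_left, norm_smul]
      have : ‖aztSg (aztExt ω j)‖ = 1 := by
        cases aztExt ω j <;> simp [aztSg]
      rw [this, one_mul]
    · rw [min_eq_right hj, min_eq_right (by omega : n ≤ j + 1), sub_self, norm_zero]
      exact hw0 j ω

lemma azt_bound {X : Type*} [NormedAddCommGroup X] [NormedSpace ℝ X] [CompleteSpace X]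
    (p K : ℝ) (hp1 : 1 < p) (hK : 0 < K) (hX : HasAzumaType X p K)
    (n : ℕ) (v : ℕ → (ℕ → Bool) → X) (t : ℝ) (ht : 0 ≤ t) (hv : aztNA v) (hb : aztBud p v n t) :
    aztEx n (fun ω => ‖aztM v n ω‖) ≤ (2 * Real.exp (1 / K) * K) * (1 + t) := by
  have := aztMu_prob n
  have e : aztEx n (fun ω => ‖aztM v n ω‖) = ∫ ω, ‖aztM v n (aztExt ω)‖ ∂(aztMu n) := by
    rw [integral_fintype Integrable.of_finite]
    simp only [aztMu_real, smul_eq_mul]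
    rw [← Finset.mul_sum]
    rfl
  set L := K * (1 + t) with hL
  have hL0 : 0 < L := by positivity
  have hKL : K ≤ L := by nlinarith
  rw [e, Integrable.integral_eq_integral_meas_le Integrable.of_finite
    (Filter.Eventually.of_forall fun ω => norm_nonneg _)]
  have hneg : -(1 / L) < 0 := by
    have : 0 < 1 / L := by positivity
    linarith
  have hi := (integrableOn_exp_mul_Ioi hneg 0).const_mul (2 * Real.exp (1 / K))
  have hval : ∫ r in Set.Ioi (0 : ℝ), 2 * Real.exp (1 / K) * Real.exp (-(1 / L) * r) =
      (2 * Real.exp (1 / K) * K) * (1 + t) := by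
    rw [integral_const_mul, integral_exp_mul_Ioi hneg 0, mul_zero, Real.exp_zero]
    have : -1 / -(1 / L) = L := by field_simp
    rw [this, hL]; ring
  rw [← hval]
  refine integral_mono_of_nonneg (Filter.Eventually.of_forall fun r => measureReal_nonneg) hi ?_
  refine (ae_restrict_iff' measurableSet_Ioi).2 (Filter.Eventually.of_forall fun r hr => ?_)
  have hr' : 0 < r := hr
  refine (azt_tail p K hp1 hK hX n v t ht hv hb r hr').trans ?_
  show _ ≤ 2 * Real.exp (1 / K) * Real.exp (-(1 / L) * r)
  rw [mul_assoc, ← Real.exp_add]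
  gcongr 2 * Real.exp ?_
  have h1 : r - 1 ≤ r ^ p := by
    rcases le_total r 1 with h | h
    · have : 0 ≤ r ^ p := by positivity
      linarith
    · have := Real.rpow_le_rpow_of_exponent_le h hp1.le
      rw [Real.rpow_one] at this
      linarith
  have h2 : -(r ^ p) / L ≤ (1 - r) / L := by
    gcongr; linarith
  have h3 : 1 / L ≤ 1 / K := one_div_le_one_div_of_le hK hKL
  have h4 : (1 - r) / L = 1 / L + -(1 / L) * r := by ring
  rw [← hL]
  linarith

theorem azuma_type_implies_uniformly_smooth_renorming
    {X : Type*} [NormedAddCommGroup X] [NormedSpace ℝ X] [CompleteSpace X]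
    (p K : ℝ) (hp1 : 1 < p) (hp2 : p ≤ 2) (hK : 0 < K)
    (hX : HasAzumaType X p K) :
    ∃ g : X → ℝ,
      -- `g` is a norm on `X`
      (∀ x, 0 ≤ g x) ∧ (∀ x, g x = 0 ↔ x = 0) ∧
      (∀ (a : ℝ) (x : X), g (a • x) = |a| * g x) ∧
      (∀ x y : X, g (x + y) ≤ g x + g y) ∧
      -- `g` is equivalent to the original norm
      (∃ C₁ C₂ : ℝ, 0 < C₁ ∧ 0 < C₂ ∧ ∀ x : X, C₁ * ‖x‖ ≤ g x ∧ g x ≤ C₂ * ‖x‖) ∧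
      -- the modulus of uniform smoothness of `(X, g)` satisfies `ρ(τ) ≤ s·τ^p`
      (∃ s : ℝ, 0 < s ∧ ∀ τ : ℝ, 0 < τ → ∀ x y : X, g x = 1 → g y = 1 →
        (g (x + τ • y) + g (x - τ • y)) / 2 - 1 ≤ s * τ ^ p) := by
  exact azt_main_B p hp1 hp2 (2 * Real.exp (1 / K) * K) (by positivity)
    (fun n v t ht hv hb => azt_bound p K hp1 hK hX n v t ht hv hb)
end
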